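/- arXiv:1812.11885 — 3 statements merged into one kernel-verified Lean document; each statement's English description precedes it below -/
import Mathlib

section
/- (Proposition 5.3, formula of Shapiro–Shapiro–Vainshtein) For integers d ≥ 1 and m ≥ 0, let N(d, m) be the number of m-tuples (τ₁, …, τ_m) of transpositions in S_d with τ₁∘τ₂∘⋯∘τ_m = (1 2 … d), and for g ≥ 0 define the 1-part simple Hurwitz number h_g(d) = N(d, d+2g−1)/(d+2g−1)!. Then for all g ≥ 0 and d ≥ 1: h_g(d) = ( (d/2)^{d+2g−1} / ( d!·(d+2g−1)! ) ) · Σ_{k=0}^{d−1} (−1)^k · binom(d−1, k) · (d−1−2k)^{d+2g−1}. -/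
/-- `Nfact d m` is the number of `m`-tuples `(τ₁, …, τ_m)` of transpositions in the
symmetric group on `d` letters with `τ₁ ∘ τ₂ ∘ ⋯ ∘ τ_m` equal to the standard `d`-cycle. -/
noncomputable def Nfact (d m : ℕ) : ℕ :=
  Nat.card {τ : Fin m → Equiv.Perm (Fin d) //
    (∀ i, (τ i).IsSwap) ∧ (List.ofFn τ).prod = finRotate d}

/-- The 1-part simple Hurwitz number `h_g(d) = N(d, d+2g−1)/(d+2g−1)!`. -/
noncomputable def hurwitz (g d : ℕ) : ℚ :=
  (Nfact d (d + 2 * g - 1) : ℚ) / ((d + 2 * g - 1).factorial : ℚ)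

open Matrix Polynomial

theorem Matrix.det_add_vecMulVec_of_det_ne_zero {R n : Type*} [CommRing R] [IsDomain R] [Fintype n]
    [DecidableEq n] {A : Matrix n n R} (hA : A.det ≠ 0) (u v : n → R) :
    (A + vecMulVec u v).det = A.det + v ⬝ᵥ A.adjugate *ᵥ u := by
  let φ := algebraMap R (FractionRing R)
  have hφ : Function.Injective φ := IsFractionRing.injective R (FractionRing R)
  apply hφ
  have hdet : (φ.mapMatrix A).det ≠ 0 := by
    rw [← RingHom.map_det]
    exact (map_ne_zero_iff φ hφ).mpr hA
  have h := det_add_replicateCol_mul_replicateRow (ι := Unit) (isUnit_iff_ne_zero.mpr hdet)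
    (φ ∘ u) (φ ∘ v)
  have hmap : φ.mapMatrix (A + vecMulVec u v) =
      φ.mapMatrix A + replicateCol Unit (φ ∘ u) * replicateRow Unit (φ ∘ v) := by
    ext i j
    simp [vecMulVec_apply, Matrix.mul_apply]
  have hinv : (replicateRow Unit (φ ∘ v) * (φ.mapMatrix A)⁻¹ * replicateCol Unit (φ ∘ u)) () () =
      (φ A.det)⁻¹ * φ (v ⬝ᵥ A.adjugate *ᵥ u) := by
    rw [Matrix.inv_def, ← RingHom.map_adjugate, ← RingHom.map_det, Matrix.mul_assoc,
      Matrix.smul_mul, Matrix.mul_smul, Ring.inverse_eq_inv', Matrix.smul_apply, smul_eq_mul]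
    congr 1
    simp [Matrix.mul_apply, dotProduct, mulVec, Finset.mul_sum]
  rw [RingHom.map_det, hmap, h, det_unique (n := Unit), ← RingHom.map_det, map_add]
  rw [← RingHom.map_det] at hdet
  simp only [PUnit.default_eq_unit, Matrix.add_apply, Matrix.one_apply_eq, hinv]
  field_simp

theorem Matrix.derivative_det {R n : Type*} [CommRing R] [Fintype n] [DecidableEq n]
    (M : Matrix n n R[X]) :
    derivative M.det = ∑ i, (M.updateCol i fun j ↦ derivative (M j i)).det := by
  simp only [det_apply', derivative_sum]
  rw [Finset.sum_comm]
  refine Finset.sum_congr rfl fun σ _ ↦ ?_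
  rw [← Finset.mul_sum, ← Polynomial.C_eq_intCast, Polynomial.derivative_C_mul]
  congr 1
  rw [derivative_prod_finset]
  refine Finset.sum_congr rfl fun i _ ↦ ?_
  rw [← Finset.mul_prod_erase _ _ (Finset.mem_univ i), mul_comm, updateCol_self]
  congr 1
  refine Finset.prod_congr rfl fun j hj ↦ ?_
  rw [updateCol_ne (Finset.ne_of_mem_erase hj)]

theorem Matrix.derivative_charpoly {R n : Type*} [CommRing R] [Fintype n] [DecidableEq n]
    (M : Matrix n n R) : derivative M.charpoly = M.charmatrix.adjugate.trace := by
  rw [charpoly, derivative_det, trace]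
  refine Finset.sum_congr rfl fun i _ ↦ ?_
  rw [diag_apply, ← transpose_apply M.charmatrix.adjugate, adjugate_transpose, adjugate_apply,
    ← det_transpose, ← updateRow_transpose]
  congr 2
  ext j : 1
  by_cases h : j = i
  · subst h; simp
  · simp [h]

theorem Fintype.sum_list_ofFn_prod_of_forall_sum_mul {G ι K : Type*} [Monoid G] [Fintype ι]
    [CommSemiring K] {v : ι → G} {F : G → K} {c : K} (hF : ∀ x, ∑ i, F (v i * x) = c * F x)
    (m : ℕ) : ∑ τ : Fin m → ι, F (List.ofFn fun i ↦ v (τ i)).prod = c ^ m * F 1 := by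
  induction m with
  | zero => simp
  | succ m ih =>
    rw [← (Fin.consEquiv fun _ ↦ ι).sum_comp, Fintype.sum_prod_type_right]
    simp only [Fin.consEquiv_apply, List.ofFn_succ, Fin.cons_zero, Fin.cons_succ, List.prod_cons,
      hF]
    rw [← Finset.mul_sum, ih, pow_succ', mul_assoc]

section PermMatrix

variable {α : Type*} [Fintype α] [DecidableEq α]

theorem Equiv.Perm.permMatrix_pow {R : Type*} [CommRing R] (σ : Equiv.Perm α) (k : ℕ) :
    (σ ^ k).permMatrix R = σ.permMatrix R ^ k := by
  induction k with
  | zero => simp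
  | succ k ih => rw [pow_succ, permMatrix_mul, ih, pow_succ']

theorem Equiv.Perm.charpoly_permMatrix_of_isCycleOn_univ [Nonempty α] {R : Type*} [CommRing R]
    [Nontrivial R] {σ : Equiv.Perm α} (hσ : σ.IsCycleOn ((Finset.univ : Finset α) : Set α)) :
    (σ.permMatrix R).charpoly = X ^ Fintype.card α - 1 := by
  set d := Fintype.card α with hd
  have hpos : 0 < d := Fintype.card_pos
  set f := (σ.permMatrix R).charpoly with hf
  obtain ⟨a⟩ := ‹Nonempty α›
  have hdeg : f.natDegree = d := charpoly_natDegree_eq_dim _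
  have hlead : f.coeff d = 1 := by
    rw [← hdeg]
    exact charpoly_monic _
  have hentry (j : ℕ) :
      ∑ k ∈ Finset.range (d + 1), (if k ≡ j [MOD d] then f.coeff k else 0) = 0 := by
    have h := congr_fun₂ (aeval_self_charpoly (σ.permMatrix R)) a ((σ ^ j) a)
    rw [aeval_eq_sum_range, ← hf, hdeg, Matrix.sum_apply, Matrix.zero_apply] at h
    refine Eq.trans (Finset.sum_congr rfl fun k _ ↦ ?_) h
    have hiff := hσ.pow_apply_eq_pow_apply (Finset.mem_univ a) (m := k) (n := j)
    rw [Finset.card_univ, ← hd] at hiff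
    simp [← Equiv.Perm.permMatrix_pow, ← hiff, eq_comm]
  have hmid {j : ℕ} (hj0 : j ≠ 0) (hjd : j < d) : f.coeff j = 0 := by
    rw [← hentry j, Finset.sum_eq_single j]
    · rw [if_pos (Nat.ModEq.refl j)]
    · intro k hk hkj
      rw [if_neg]
      intro hmod
      rcases (Nat.lt_succ_iff.mp (Finset.mem_range.mp hk)).lt_or_eq with hlt | rfl
      · exact hkj (hmod.eq_of_lt_of_lt hlt hjd)
      · rw [Nat.ModEq, Nat.mod_self, Nat.mod_eq_of_lt hjd] at hmod
        exact hj0 hmod.symm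
    · intro h
      exact absurd (Finset.mem_range.mpr (by omega)) h
  have hzero : f.coeff 0 = -1 := by
    have h := hentry 0
    rw [Finset.sum_range_succ, if_pos (by simp [Nat.ModEq]), hlead,
      Finset.sum_eq_single_of_mem 0 (Finset.mem_range.mpr hpos), if_pos (Nat.ModEq.refl 0)] at h
    · exact eq_neg_of_add_eq_zero_left h
    · intro k hk hk0
      rw [hmid hk0 (Finset.mem_range.mp hk), ite_self]
  ext j
  rw [coeff_sub, coeff_X_pow, coeff_one]
  rcases lt_trichotomy j d with h | rfl | h
  · by_cases h0 : j = 0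
    · subst h0
      simp [hzero, h.ne]
    · rw [hmid h0 h, if_neg h.ne, if_neg h0, sub_zero]
  · rw [hlead, if_pos rfl, if_neg hpos.ne', sub_zero]
  · rw [coeff_eq_zero_of_natDegree_lt (hdeg ▸ h), if_neg h.ne', if_neg (by omega), sub_zero]

theorem Matrix.trace_adjugate_one_sub_permMatrix_eq_zero {R : Type*} [CommRing R] [IsDomain R]
    {σ : Equiv.Perm α} (hσ : ¬ σ.IsCycleOn ((Finset.univ : Finset α) : Set α)) :
    (1 - σ.permMatrix R).adjugate.trace = 0 := by
  classical
  refine Finset.sum_eq_zero fun i _ ↦ ?_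
  have hex : ∃ j, ¬ σ.SameCycle i j := by
    by_contra! h
    refine hσ ⟨by simp, fun x _ y _ ↦ (h x).symm.trans (h y)⟩
  obtain ⟨j, hj⟩ := hex
  rw [diag_apply, adjugate_apply, ← exists_mulVec_eq_zero_iff]
  refine ⟨fun k ↦ if σ.SameCycle i k then 0 else 1, fun h ↦ ?_, ?_⟩
  · simpa [hj] using congr_fun h j
  · ext k
    by_cases hk : k = i
    · subst hk
      simp [mulVec, Equiv.Perm.SameCycle.refl]
    · rw [mulVec, updateRow_ne hk, ← mulVec, Matrix.sub_mulVec, one_mulVec, permMatrix_mulVec]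
      simp

theorem Polynomial.eval_derivative_charpoly_permMatrix [Nonempty α] {R : Type*} [CommRing R]
    [IsDomain R] (σ : Equiv.Perm α)
    [Decidable (σ.IsCycleOn ((Finset.univ : Finset α) : Set α))] :
    (derivative (σ.permMatrix R).charpoly).eval 1 =
      if σ.IsCycleOn ((Finset.univ : Finset α) : Set α) then (Fintype.card α : R) else 0 := by
  split_ifs with h
  · rw [Equiv.Perm.charpoly_permMatrix_of_isCycleOn_univ h]
    simp [derivative_X_pow]
  · rw [derivative_charpoly, ← Matrix.trace_adjugate_one_sub_permMatrix_eq_zero h,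
      ← coe_evalRingHom, AddMonoidHom.map_trace, ← RingHom.mapMatrix_apply, RingHom.map_adjugate]
    congr 2
    ext i j
    by_cases hij : i = j
    · subst hij; simp [apply_ite (eval (1 : R))]
    · simp [hij, apply_ite (eval (1 : R))]

theorem Equiv.Perm.sum_offDiag_swap [DecidablePred (Equiv.Perm.IsSwap (α := α))]
    {M : Type*} [AddCommMonoid M] (F : Equiv.Perm α → M) :
    ∑ p ∈ (Finset.univ : Finset α).offDiag, F (Equiv.swap p.1 p.2) =
      2 • ∑ s : Equiv.Perm α with s.IsSwap, F s := by
  rw [← Finset.sum_fiberwise_of_maps_to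
    (t := (Finset.univ : Finset (Equiv.Perm α)).filter Equiv.Perm.IsSwap)
    (g := fun p : α × α ↦ Equiv.swap p.1 p.2), Finset.smul_sum]
  · refine Finset.sum_congr rfl fun s hs ↦ ?_
    obtain ⟨x, y, hxy, rfl⟩ := (Finset.mem_filter.mp hs).2
    have hfiber : (Finset.univ : Finset α).offDiag.filter
        (fun p : α × α ↦ Equiv.swap p.1 p.2 = Equiv.swap x y) = {(x, y), (y, x)} := by
      ext ⟨i, j⟩
      simp only [Finset.mem_filter, Finset.mem_offDiag, Finset.mem_univ, true_and,
        Finset.mem_insert, Finset.mem_singleton, Prod.mk.injEq]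
      constructor
      · rintro ⟨hij, h⟩
        have hi := Equiv.congr_fun h i
        rw [Equiv.swap_apply_left, Equiv.swap_apply_def] at hi
        grind
      · rintro (⟨rfl, rfl⟩ | ⟨rfl, rfl⟩)
        · exact ⟨hxy, rfl⟩
        · exact ⟨hxy.symm, Equiv.swap_comm _ _⟩
    rw [Finset.sum_congr rfl fun p hp ↦ congrArg F (Finset.mem_filter.mp hp).2, Finset.sum_const,
      hfiber, Finset.card_pair (by simp [hxy])]
  · rintro ⟨i, j⟩ hp
    exact Finset.mem_filter.mpr ⟨Finset.mem_univ _, i, j, (Finset.mem_offDiag.mp hp).2.2, rfl⟩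

theorem Equiv.Perm.permMatrix_swap {β : Type*} [DecidableEq β] {R : Type*} [CommRing R]
    (i j : β) :
    (Equiv.swap i j).permMatrix R =
      1 - vecMulVec (Pi.single i 1 - Pi.single j 1) (Pi.single i 1 - Pi.single j 1) := by
  ext a b
  simp only [Equiv.Perm.permMatrix, PEquiv.toMatrix_toPEquiv_apply, Equiv.swap_apply_def,
    Matrix.sub_apply, Matrix.one_apply, vecMulVec_apply, Pi.sub_apply, Pi.single_apply]
  by_cases h1 : a = i <;> by_cases h2 : a = j <;> by_cases h3 : b = i <;> by_cases h4 : b = j <;>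
    by_cases h5 : a = b <;> simp_all
  all_goals grind

theorem Equiv.Perm.charpoly_permMatrix_swap_mul {R : Type*} [CommRing R] [IsDomain R]
    (σ : Equiv.Perm α) (i j : α) {M : Matrix α α R[X]}
    (hM : M = (σ.permMatrix R).charmatrix.adjugate * (σ.permMatrix R).map C) :
    ((Equiv.swap i j * σ).permMatrix R).charpoly =
      (σ.permMatrix R).charpoly + (M i i + M j j - M i j - M j i) := by
  set u : α → R[X] := Pi.single i 1 - Pi.single j 1 with hu
  have hchar : ((Equiv.swap i j * σ).permMatrix R).charmatrix =
      (σ.permMatrix R).charmatrix + vecMulVec ((σ.permMatrix R).map C *ᵥ u) u := by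
    have hmap : ((Equiv.swap i j).permMatrix R).map C = 1 - vecMulVec u u := by
      rw [← Equiv.Perm.permMatrix_swap]
      ext a b : 1
      simp [apply_ite (C : R → R[X])]
    rw [permMatrix_mul, charmatrix, charmatrix, RingHom.mapMatrix_apply, RingHom.mapMatrix_apply,
      Matrix.map_mul, hmap, Matrix.mul_sub, Matrix.mul_one, Matrix.mul_vecMulVec]
    abel
  rw [charpoly, hchar, det_add_vecMulVec_of_det_ne_zero (charpoly_monic _).ne_zero, charpoly,
    mulVec_mulVec, ← hM]
  congr 1
  simp only [hu, mulVec_sub, mulVec_single_one, dotProduct_sub, sub_dotProduct, single_dotProduct,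
    one_mul, col_apply]
  ring

theorem Equiv.Perm.X_sub_one_mul_sum_charpoly_permMatrix_swap_mul {R : Type*} [CommRing R]
    [IsDomain R] [DecidablePred (Equiv.Perm.IsSwap (α := α))] (σ : Equiv.Perm α) :
    (X - 1) * (2 * ∑ s : Equiv.Perm α with s.IsSwap, ((s * σ).permMatrix R).charpoly) =
      (X - 1) * ((Fintype.card α : R[X]) * ((Fintype.card α : R[X]) - 1) * (σ.permMatrix R).charpoly
        + 2 * (Fintype.card α : R[X]) * (X * derivative (σ.permMatrix R).charpoly
          - (Fintype.card α : R[X]) * (σ.permMatrix R).charpoly))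
      - 2 * (Fintype.card α : R[X]) * (σ.permMatrix R).charpoly := by
  set f := (σ.permMatrix R).charpoly with hf
  set B := (σ.permMatrix R).charmatrix with hB
  set Q := (σ.permMatrix R).map (C : R →+* R[X]) with hQ
  set M := B.adjugate * Q with hM
  set d := (Fintype.card α : R[X]) with hd
  have hBQ : B = scalar α (X : R[X]) - Q := rfl
  have hQone : Q *ᵥ 1 = 1 := by
    ext a : 1
    simp [hQ, mulVec, dotProduct]
  have htrace : M.trace = X * derivative f - d * f := by
    have : M = (X : R[X]) • B.adjugate - f • (1 : Matrix α α R[X]) := by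
      have hQB : Q = scalar α (X : R[X]) - B := by rw [hBQ, sub_sub_cancel]
      rw [hf, charpoly, ← adjugate_mul, ← hB, hM, hQB, Matrix.mul_sub,
        scalar_apply, ← smul_one_eq_diagonal, Matrix.mul_smul, Matrix.mul_one]
    rw [this, trace_sub, trace_smul, trace_smul, trace_one, hf, derivative_charpoly, smul_eq_mul,
      smul_eq_mul, mul_comm _ d]
  have hsum : (X - 1) * ∑ i, ∑ j, M i j = d * f := by
    have hM1 : M *ᵥ 1 = B.adjugate *ᵥ 1 := by rw [hM, ← mulVec_mulVec, hQone]
    have hB1 : B *ᵥ 1 = (X - 1 : R[X]) • 1 := by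
      rw [hBQ, sub_mulVec, hQone, scalar_apply, ← smul_one_eq_diagonal, smul_mulVec, one_mulVec,
        sub_smul, one_smul]
    have h : (X - 1 : R[X]) • (M *ᵥ 1) = f • 1 := by
      rw [hM1, ← mulVec_smul, ← hB1, mulVec_mulVec, adjugate_mul, smul_mulVec, one_mulVec]
      rfl
    have hrow (i : α) : (X - 1) * ∑ j, M i j = f := by
      simpa [mulVec, dotProduct] using congr_fun h i
    rw [Finset.mul_sum, Finset.sum_congr rfl fun i _ ↦ hrow i]
    simp [d]
  have hswap : 2 * ∑ s : Equiv.Perm α with s.IsSwap, ((s * σ).permMatrix R).charpoly =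
      d * (d - 1) * f + 2 * d * M.trace - 2 * ∑ i, ∑ j, M i j := by
    have hall : ∑ p : α × α, ((Equiv.swap p.1 p.2 * σ).permMatrix R).charpoly =
        d * d * f + 2 * d * M.trace - 2 * ∑ i, ∑ j, M i j := by
      rw [Fintype.sum_prod_type, Finset.sum_congr rfl fun i _ ↦ Finset.sum_congr rfl fun j _ ↦
        σ.charpoly_permMatrix_swap_mul i j hM]
      simp only [Finset.sum_add_distrib, Finset.sum_sub_distrib, Finset.sum_const,
        Finset.card_univ, nsmul_eq_mul, ← hd, ← hf, ← Finset.mul_sum, trace, diag_apply]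
      rw [Finset.sum_comm (f := fun i j ↦ M j i)]
      ring
    have hdiag : ∑ p ∈ (Finset.univ : Finset α).diag,
        ((Equiv.swap p.1 p.2 * σ).permMatrix R).charpoly = d * f := by
      rw [Finset.sum_diag]
      simp [hd, hf]
    have hsplit := Finset.sum_union (Finset.disjoint_diag_offDiag (Finset.univ : Finset α))
      (f := fun p ↦ ((Equiv.swap p.1 p.2 * σ).permMatrix R).charpoly)
    have hoff := Equiv.Perm.sum_offDiag_swap fun s ↦ ((s * σ).permMatrix R).charpoly
    rw [nsmul_eq_mul, Nat.cast_ofNat] at hoff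
    rw [Finset.diag_union_offDiag, Finset.univ_product_univ, hall, hdiag, hoff] at hsplit
    linear_combination -hsplit
  rw [hswap, htrace]
  linear_combination (-2 : R[X]) * hsum

/-- The characteristic polynomial of a permutation acting on the quotient of `R ^ α` by the
constant vectors. -/
noncomputable def Equiv.Perm.reducedCharpoly (R : Type*) [CommRing R] (σ : Equiv.Perm α) : R[X] :=
  (σ.permMatrix R).charpoly /ₘ (X - C 1)

theorem Equiv.Perm.X_sub_one_mul_reducedCharpoly [Nonempty α] {R : Type*} [CommRing R] [IsDomain R]
    (σ : Equiv.Perm α) : (X - 1) * σ.reducedCharpoly R = (σ.permMatrix R).charpoly := by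
  rw [← C_1, reducedCharpoly, mul_divByMonic_eq_iff_isRoot, IsRoot, eval_charpoly,
    ← exists_mulVec_eq_zero_iff]
  refine ⟨1, one_ne_zero, ?_⟩
  rw [sub_mulVec, permMatrix_mulVec, map_one, one_mulVec]
  ext i
  simp

theorem Equiv.Perm.two_mul_sum_reducedCharpoly_swap_mul [Nonempty α] {R : Type*} [CommRing R]
    [IsDomain R] [DecidablePred (Equiv.Perm.IsSwap (α := α))] (σ : Equiv.Perm α) :
    2 * ∑ s : Equiv.Perm α with s.IsSwap, (s * σ).reducedCharpoly R =
      2 * (Fintype.card α : R[X]) * (X * derivative (σ.reducedCharpoly R))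
      - (Fintype.card α : R[X]) * ((Fintype.card α : R[X]) - 1) * σ.reducedCharpoly R := by
  have hX : (X - 1 : R[X]) ≠ 0 := by
    rw [← C_1]
    exact X_sub_C_ne_zero 1
  have h := σ.X_sub_one_mul_sum_charpoly_permMatrix_swap_mul (R := R)
  simp only [← X_sub_one_mul_reducedCharpoly, ← Finset.mul_sum, derivative_mul, derivative_sub,
    derivative_X, derivative_one] at h
  apply mul_left_cancel₀ (mul_ne_zero hX hX)
  linear_combination h

theorem Equiv.Perm.sum_coeff_reducedCharpoly_swap_mul [Nonempty α] {K : Type*} [Field K]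
    [CharZero K] [DecidablePred (Equiv.Perm.IsSwap (α := α))] (σ : Equiv.Perm α) (k : ℕ) :
    ∑ s : {s : Equiv.Perm α // s.IsSwap}, ((s.1 * σ).reducedCharpoly K).coeff k =
      (Fintype.card α : K) / 2 * (2 * k - (Fintype.card α - 1)) * (σ.reducedCharpoly K).coeff k := by
  have h := congrArg (fun p ↦ p.coeff k) (σ.two_mul_sum_reducedCharpoly_swap_mul (R := K))
  have hX : (X * derivative (σ.reducedCharpoly K)).coeff k = k * (σ.reducedCharpoly K).coeff k := by
    cases k with
    | zero => simp
    | succ k =>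
      rw [coeff_X_mul, coeff_derivative]
      push_cast
      ring
  have hrew : 2 * (Fintype.card α : K[X]) * (X * derivative (σ.reducedCharpoly K))
      - (Fintype.card α : K[X]) * ((Fintype.card α : K[X]) - 1) * σ.reducedCharpoly K =
      C (2 * (Fintype.card α : K)) * (X * derivative (σ.reducedCharpoly K))
      - C ((Fintype.card α : K) * ((Fintype.card α : K) - 1)) * σ.reducedCharpoly K := by
    simp only [map_mul, map_sub, map_natCast, map_one, map_ofNat]
  rw [hrew, ← C_ofNat] at h
  simp only [coeff_sub, coeff_C_mul, hX, finsetSum_coeff] at h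
  rw [Finset.sum_subtype (p := fun s : Equiv.Perm α ↦ s.IsSwap) _ (by simp)] at h
  linear_combination h / 2

theorem Equiv.Perm.coeff_reducedCharpoly_one [Nonempty α] {R : Type*} [CommRing R] [IsDomain R]
    (k : ℕ) : ((1 : Equiv.Perm α).reducedCharpoly R).coeff k =
      (-1) ^ (Fintype.card α - 1 - k) * ((Fintype.card α - 1).choose k : R) := by
  have h := (1 : Equiv.Perm α).X_sub_one_mul_reducedCharpoly (R := R)
  have hX : (X - 1 : R[X]) ≠ 0 := by
    rw [← C_1]
    exact X_sub_C_ne_zero 1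
  obtain ⟨n, hn⟩ := Nat.exists_eq_succ_of_ne_zero (Fintype.card_ne_zero (α := α))
  rw [permMatrix_one, charpoly_one, hn, pow_succ'] at h
  rw [mul_left_cancel₀ hX h, hn, Nat.succ_sub_one, ← coeff_X_add_C_pow, C_neg, C_1, sub_eq_add_neg]

theorem Equiv.Perm.eval_reducedCharpoly [Nonempty α] {R : Type*} [CommRing R] [IsDomain R]
    (σ : Equiv.Perm α) [Decidable (σ.IsCycleOn ((Finset.univ : Finset α) : Set α))] :
    (σ.reducedCharpoly R).eval 1 =
      if σ.IsCycleOn ((Finset.univ : Finset α) : Set α) then (Fintype.card α : R) else 0 := by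
  rw [← eval_derivative_charpoly_permMatrix, ← X_sub_one_mul_reducedCharpoly]
  simp

theorem Equiv.Perm.natDegree_reducedCharpoly_lt [Nonempty α] {R : Type*} [CommRing R] [IsDomain R]
    (σ : Equiv.Perm α) : (σ.reducedCharpoly R).natDegree < Fintype.card α := by
  rw [reducedCharpoly, natDegree_divByMonic _ (monic_X_sub_C 1), charpoly_natDegree_eq_dim,
    natDegree_X_sub_C]
  exact Nat.sub_lt Fintype.card_pos one_pos

theorem Equiv.Perm.isCycleOn_univ_iff_cycleType_eq (hα : 2 ≤ Fintype.card α) {σ : Equiv.Perm α} :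
    σ.IsCycleOn ((Finset.univ : Finset α) : Set α) ↔ σ.cycleType = {Fintype.card α} := by
  have hnt : ((Finset.univ : Finset α) : Set α).Nontrivial := by
    rw [Finset.coe_univ, Set.nontrivial_univ_iff, ← Fintype.one_lt_card_iff_nontrivial]
    exact hα
  constructor
  · intro h
    have hc : σ.IsCycle := Equiv.Perm.isCycle_iff_exists_isCycleOn.mpr ⟨_, hnt, h, by simp⟩
    have hs : σ.support = Finset.univ := Finset.eq_univ_iff_forall.mpr fun x ↦
      Equiv.Perm.mem_support.mpr (h.apply_ne hnt (by simp))
    rw [hc.cycleType, hs, Finset.card_univ]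
  · intro h
    have hc : σ.IsCycle := Equiv.Perm.card_cycleType_eq_one.mp (by simp [h])
    have hs : σ.support = Finset.univ := by
      rw [← Finset.card_eq_iff_eq_univ, ← Equiv.Perm.sum_cycleType, h, Multiset.sum_singleton]
    convert hc.isCycleOn using 1
    ext x
    simpa using Finset.eq_univ_iff_forall.mp hs x

theorem Equiv.Perm.isConj_of_isCycleOn_univ {σ τ : Equiv.Perm α}
    (hσ : σ.IsCycleOn ((Finset.univ : Finset α) : Set α))
    (hτ : τ.IsCycleOn ((Finset.univ : Finset α) : Set α)) : IsConj σ τ := by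
  rcases lt_or_ge (Fintype.card α) 2 with h | h
  · have : Subsingleton α := Fintype.card_le_one_iff_subsingleton.mp (by omega)
    rw [Subsingleton.elim σ τ]
  · rw [Equiv.Perm.isConj_iff_cycleType_eq, (isCycleOn_univ_iff_cycleType_eq h).mp hσ,
      (isCycleOn_univ_iff_cycleType_eq h).mp hτ]

theorem Equiv.Perm.card_isCycleOn_univ [Nonempty α]
    [DecidablePred fun σ : Equiv.Perm α ↦ σ.IsCycleOn ((Finset.univ : Finset α) : Set α)] :
    (Finset.univ.filter fun σ : Equiv.Perm α ↦
      σ.IsCycleOn ((Finset.univ : Finset α) : Set α)).card = (Fintype.card α - 1).factorial := by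
  rcases lt_or_ge (Fintype.card α) 2 with h | h
  · have hc : Fintype.card α = 1 := by have := Fintype.card_pos (α := α); omega
    have : Subsingleton α := Fintype.card_le_one_iff_subsingleton.mp hc.le
    rw [Finset.filter_true_of_mem fun σ _ ↦ Equiv.Perm.isCycleOn_of_subsingleton σ _,
      Finset.card_univ, Fintype.card_perm, hc]
    rfl
  · simp only [isCycleOn_univ_iff_cycleType_eq h]
    rw [Equiv.Perm.card_of_cycleType_singleton h le_rfl, Nat.choose_self, mul_one]

theorem Equiv.Perm.card_swap_factorizations_eq_of_isConj {β : Type*} [DecidableEq β]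
    {σ σ' : Equiv.Perm β} (h : IsConj σ σ') (m : ℕ) :
    Nat.card {τ : Fin m → Equiv.Perm β // (∀ i, (τ i).IsSwap) ∧ (List.ofFn τ).prod = σ} =
      Nat.card {τ : Fin m → Equiv.Perm β // (∀ i, (τ i).IsSwap) ∧ (List.ofFn τ).prod = σ'} := by
  obtain ⟨g, rfl⟩ := isConj_iff.mp h
  refine Nat.card_congr (Equiv.subtypeEquiv
    (Equiv.piCongrRight fun _ ↦ (MulAut.conj g).toEquiv) fun τ ↦ and_congr ?_ ?_)
  · refine forall_congr' fun i ↦ ?_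
    have hconj (s g : Equiv.Perm β) (hs : s.IsSwap) : (g * s * g⁻¹).IsSwap := by
      obtain ⟨x, y, hxy, rfl⟩ := hs
      exact ⟨g x, g y, g.injective.ne hxy, (Equiv.swap_apply_apply g x y).symm⟩
    refine ⟨hconj _ g, fun hs ↦ ?_⟩
    simpa [mul_assoc] using hconj _ g⁻¹ hs
  · rw [← MulAut.conj_apply, ← (MulAut.conj g).injective.eq_iff, map_list_prod, List.map_ofFn]
    rfl

theorem Equiv.Perm.card_swap_factorizations_of_isCycleOn_univ [Nonempty α] {σ : Equiv.Perm α}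
    (hσ : σ.IsCycleOn ((Finset.univ : Finset α) : Set α)) (m : ℕ) :
    ((Fintype.card α).factorial : ℚ) *
      Nat.card {τ : Fin m → Equiv.Perm α // (∀ i, (τ i).IsSwap) ∧ (List.ofFn τ).prod = σ} =
      ∑ k ∈ Finset.range (Fintype.card α),
        ((Fintype.card α : ℚ) / 2 * (2 * k - (Fintype.card α - 1))) ^ m *
          ((-1) ^ (Fintype.card α - 1 - k) * ((Fintype.card α - 1).choose k : ℚ)) := by
  classical
  set d := Fintype.card α with hd
  let S := {s : Equiv.Perm α // s.IsSwap}
  let p (τ : Fin m → S) : Equiv.Perm α := (List.ofFn fun i ↦ (τ i).1).prod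
  have hcard (σ' : Equiv.Perm α) :
      Nat.card {τ : Fin m → Equiv.Perm α // (∀ i, (τ i).IsSwap) ∧ (List.ofFn τ).prod = σ'} =
        (Finset.univ.filter fun τ ↦ p τ = σ').card := by
    rw [← Fintype.card_subtype, ← Nat.card_eq_fintype_card]
    refine (Nat.card_congr ?_).symm
    exact {
      toFun := fun τ ↦ ⟨fun i ↦ (τ.1 i).1, fun i ↦ (τ.1 i).2, τ.2⟩
      invFun := fun τ ↦ ⟨fun i ↦ ⟨τ.1 i, τ.2.1 i⟩, τ.2.2⟩
      left_inv := fun _ ↦ rfl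
      right_inv := fun _ ↦ rfl }
  have hcount : (Finset.univ.filter fun τ ↦
      (p τ).IsCycleOn ((Finset.univ : Finset α) : Set α)).card = (d - 1).factorial *
        Nat.card {τ : Fin m → Equiv.Perm α // (∀ i, (τ i).IsSwap) ∧ (List.ofFn τ).prod = σ} := by
    rw [Finset.card_eq_sum_card_fiberwise (f := p) (t := Finset.univ.filter fun σ : Equiv.Perm α ↦
      σ.IsCycleOn ((Finset.univ : Finset α) : Set α)) (by intro τ hτ; simpa using hτ),
      ← card_isCycleOn_univ, ← smul_eq_mul, ← Finset.sum_const]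
    refine Finset.sum_congr rfl fun σ' hσ' ↦ ?_
    have hσ'' := (Finset.mem_filter.mp hσ').2
    rw [card_swap_factorizations_eq_of_isConj (isConj_of_isCycleOn_univ hσ hσ''), hcard,
      Finset.filter_filter]
    congr 1
    refine Finset.filter_congr fun τ _ ↦ and_iff_right_of_imp ?_
    rintro rfl
    exact hσ''
  have heval : ∑ τ : Fin m → S, ((p τ).reducedCharpoly ℚ).eval 1 =
      d * (Finset.univ.filter fun τ ↦
        (p τ).IsCycleOn ((Finset.univ : Finset α) : Set α)).card := by
    simp only [eval_reducedCharpoly, ← Finset.sum_filter, Finset.sum_const, nsmul_eq_mul]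
    rw [mul_comm]
  have hsum : ∑ τ : Fin m → S, ((p τ).reducedCharpoly ℚ).eval 1 =
      ∑ k ∈ Finset.range d, ∑ τ : Fin m → S, ((p τ).reducedCharpoly ℚ).coeff k := by
    rw [Finset.sum_comm]
    refine Finset.sum_congr rfl fun τ _ ↦ ?_
    simp [eval_eq_sum_range' (natDegree_reducedCharpoly_lt (p τ)), hd]
  rw [heval, hcount] at hsum
  rw [← Nat.mul_factorial_pred (Fintype.card_ne_zero (α := α)), ← hd]
  push_cast at hsum ⊢
  rw [mul_assoc, hsum]
  refine Finset.sum_congr rfl fun k _ ↦ ?_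
  rw [← coeff_reducedCharpoly_one]
  exact Fintype.sum_list_ofFn_prod_of_forall_sum_mul
    (F := fun σ : Equiv.Perm α ↦ (σ.reducedCharpoly ℚ).coeff k)
    (fun σ ↦ sum_coeff_reducedCharpoly_swap_mul σ k) m

end PermMatrix

theorem isCycleOn_univ_finRotate (d : ℕ) :
    (finRotate d).IsCycleOn ((Finset.univ : Finset (Fin d)) : Set (Fin d)) := by
  rcases lt_or_ge d 2 with h | h
  · have : Subsingleton (Fin d) := Fin.subsingleton_iff_le_one.mpr (by omega)
    exact Equiv.Perm.isCycleOn_of_subsingleton _ _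
  · rw [Equiv.Perm.isCycleOn_univ_iff_cycleType_eq (by simpa using h), cycleType_finRotate_of_le h,
      Fintype.card_fin]

/-- The Shapiro–Shapiro–Vainshtein formula for 1-part simple Hurwitz numbers. -/
theorem one_part_hurwitz_formula (g d : ℕ) (hd : 1 ≤ d) :
    hurwitz g d =
      ((d : ℚ) / 2) ^ (d + 2 * g - 1) /
          ((d.factorial : ℚ) * ((d + 2 * g - 1).factorial : ℚ)) *
        ∑ k ∈ Finset.range d,
          (-1 : ℚ) ^ k * ((d - 1).choose k : ℚ) *
            (((d : ℤ) - 1 - 2 * (k : ℤ) : ℤ) : ℚ) ^ (d + 2 * g - 1) := by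
  have : Nonempty (Fin d) := ⟨⟨0, hd⟩⟩
  have h := Equiv.Perm.card_swap_factorizations_of_isCycleOn_univ (isCycleOn_univ_finRotate d)
    (d + 2 * g - 1)
  rw [Fintype.card_fin, ← Nfact, ← Finset.sum_range_reflect] at h
  have hterm : ∀ k ∈ Finset.range d,
      ((d : ℚ) / 2 * (2 * ((d - 1 - k : ℕ) : ℚ) - (d - 1))) ^ (d + 2 * g - 1) *
        ((-1) ^ (d - 1 - (d - 1 - k)) * ((d - 1).choose (d - 1 - k) : ℚ)) =
      ((d : ℚ) / 2) ^ (d + 2 * g - 1) * ((-1 : ℚ) ^ k * ((d - 1).choose k : ℚ) *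
        (((d : ℤ) - 1 - 2 * (k : ℤ) : ℤ) : ℚ) ^ (d + 2 * g - 1)) := by
    intro k hk
    have hkd : k ≤ d - 1 := Nat.le_sub_one_of_lt (Finset.mem_range.mp hk)
    rw [Nat.choose_symm hkd, Nat.sub_sub_self hkd, mul_pow, Nat.cast_sub hkd, Nat.cast_sub hd]
    push_cast
    ring
  rw [Finset.sum_congr rfl hterm, ← Finset.mul_sum] at h
  have hfac : (d.factorial : ℚ) ≠ 0 := Nat.cast_ne_zero.mpr d.factorial_ne_zero
  rw [hurwitz, eq_div_of_mul_eq hfac ((mul_comm _ _).trans h)]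
  field_simp
end

section
/- (Corollary 5.5, explicit formula for 1-part monotone Hurwitz numbers) For integers d ≥ 1 and m ≥ 0, let M(d, m) be the number of monotone m-tuples (τ₁, …, τ_m) of transpositions in S_d (i.e. writing τ_i = (a_i b_i) with a_i < b_i, one has b₁ ≤ ⋯ ≤ b_m) whose product τ₁∘⋯∘τ_m is a d-cycle, and for g ≥ 0 define m_g(d) = M(d, d+2g−1)/(d−1)!. Then for all g ≥ 0 and d ≥ 1: m_g(d) = ( (2d−2)! / (d!·(d−1)!) ) · Σ_{1 ≤ m₁ ≤ m₂ ≤ ⋯ ≤ m_g ≤ d−1} (m₁·m₂·⋯·m_g)², where the sum is over weakly increasing g-tuples of integers in {1, …, d−1} (for g = 0 the empty sum of the empty product equals 1). -/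
open scoped Classical

/-- `Mono d m` is the number of monotone `m`-tuples of transpositions in the symmetric
group on `d` letters whose product is a `d`-cycle: a tuple is encoded by the pairs
`(aᵢ, bᵢ)` with `aᵢ < bᵢ` and the higher elements `bᵢ` weakly increasing, and the
product `τ₁ ∘ ⋯ ∘ τ_m` is required to have the same cycle type as the standard
`d`-cycle. -/
noncomputable def Mono (d m : ℕ) : ℕ :=
  Nat.card {f : Fin m → Fin d × Fin d //
    (∀ i, (f i).1 < (f i).2) ∧
    (∀ i j : Fin m, i ≤ j → (f i).2 ≤ (f j).2) ∧
    (List.ofFn fun i => Equiv.swap (f i).1 (f i).2).prod.cycleType =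
      (finRotate d).cycleType}

/-- The 1-part monotone Hurwitz number `m_g(d) = M(d, d+2g−1)/(d−1)!`. -/
noncomputable def monotoneHurwitz (g d : ℕ) : ℚ :=
  (Mono d (d + 2 * g - 1) : ℚ) / ((d - 1).factorial : ℚ)

open PowerSeries Equiv
open scoped Matrix

section Jacobi

theorem Derivation.map_prod {R A κ : Type*} [CommRing R] [CommRing A] [Algebra R A] [DecidableEq κ]
    (D : Derivation R A A) (s : Finset κ) (f : κ → A) :
    D (∏ i ∈ s, f i) = ∑ i ∈ s, D (f i) * ∏ j ∈ s.erase i, f j := by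
  induction s using Finset.induction_on with
  | empty => simp
  | insert a s ha ih =>
    rw [Finset.prod_insert ha, D.leibniz, Finset.sum_insert ha, Finset.erase_insert ha, ih,
      add_comm, smul_eq_mul, smul_eq_mul, Finset.mul_sum, mul_comm (∏ i ∈ s, f i)]
    congr 1
    refine Finset.sum_congr rfl fun i hi => ?_
    have hne : a ≠ i := fun h => ha (h ▸ hi)
    rw [Finset.erase_insert_of_ne hne,
      Finset.prod_insert (fun h => ha (Finset.mem_of_mem_erase h))]
    ring

variable {R A ι : Type*} [CommRing R] [CommRing A] [Algebra R A] [Fintype ι] [DecidableEq ι]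

/-- Jacobi's formula, column by column. -/
theorem Derivation.map_det (D : Derivation R A A) (M : Matrix ι ι A) :
    D M.det = ∑ i, (M.updateCol i fun j => D (M j i)).det := by
  simp_rw [Matrix.det_apply, map_sum]
  rw [Finset.sum_comm]
  refine Finset.sum_congr rfl fun σ _ => ?_
  rw [Units.smul_def, map_zsmul, D.map_prod, Finset.smul_sum]
  refine Finset.sum_congr rfl fun i _ => ?_
  rw [Units.smul_def, ← Finset.mul_prod_erase _ _ (Finset.mem_univ i), Matrix.updateCol_self]
  congr 2
  refine Finset.prod_congr rfl fun j hj => ?_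
  rw [Matrix.updateCol_ne (Finset.ne_of_mem_erase hj)]

theorem Derivation.map_det_eq_trace (D : Derivation R A A) (M : Matrix ι ι A) :
    D M.det = (M.adjugate * M.map D).trace := by
  rw [D.map_det, Matrix.trace]
  refine Finset.sum_congr rfl fun i _ => ?_
  rw [← Matrix.cramer_apply, Matrix.cramer_eq_adjugate_mulVec]
  rfl

theorem Matrix.det_one_add_vecMulVec (u v : ι → A) :
    (1 + Matrix.vecMulVec u v).det = 1 + v ⬝ᵥ u := by
  rw [Matrix.vecMulVec_eq Unit, Matrix.det_one_add_replicateCol_mul_replicateRow]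

end Jacobi

section Pencil

variable {ι : Type*} [Fintype ι] [DecidableEq ι]

/-- The permutation matrix of `σ`, with power series entries. -/
noncomputable def permSeries (σ : Perm ι) : Matrix ι ι ℚ⟦X⟧ :=
  Matrix.of fun i j => if i = σ j then 1 else 0

/-- The matrix `1 - X σ`. -/
noncomputable def pencil (σ : Perm ι) : Matrix ι ι ℚ⟦X⟧ := 1 - (X : ℚ⟦X⟧) • permSeries σ

/-- The resolvent `(1 - X σ)⁻¹`. -/
noncomputable def permResolvent (σ : Perm ι) : Matrix ι ι ℚ⟦X⟧ := (pencil σ)⁻¹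

theorem isUnit_det_pencil (σ : Perm ι) : IsUnit (pencil σ).det := by
  rw [PowerSeries.isUnit_iff_constantCoeff, RingHom.map_det]
  have : (constantCoeff (R := ℚ)).mapMatrix (pencil σ) = 1 := by
    ext i j
    by_cases h : i = j <;> simp [pencil, Matrix.one_apply, h]
  rw [this, Matrix.det_one]
  exact isUnit_one

theorem pencil_mul_resolvent (σ : Perm ι) : pencil σ * permResolvent σ = 1 :=
  Matrix.mul_nonsing_inv _ (isUnit_det_pencil σ)

theorem resolvent_mul_pencil (σ : Perm ι) : permResolvent σ * pencil σ = 1 :=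
  Matrix.nonsing_inv_mul _ (isUnit_det_pencil σ)

/-- The difference of two standard basis vectors. -/
noncomputable def rootVec (i k : ι) : ι → ℚ⟦X⟧ := Pi.single i 1 - Pi.single k 1

theorem permSeries_mul_swap (σ : Perm ι) (i k : ι) :
    permSeries (σ * swap i k) =
      permSeries σ - Matrix.vecMulVec (permSeries σ *ᵥ rootVec i k) (rootVec i k) := by
  ext1 a b
  have h : (permSeries σ *ᵥ rootVec i k) a = permSeries σ a i - permSeries σ a k := by
    simp [rootVec, Matrix.mulVec_sub]
  simp only [Matrix.sub_apply, Matrix.vecMulVec_apply, h]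
  simp only [permSeries, Matrix.of_apply, rootVec, Pi.sub_apply, Pi.single_apply, Perm.mul_apply]
  rcases eq_or_ne b i with rfl | hi
  · rcases eq_or_ne b k with rfl | hk
    · simp
    · simp [hk]
  · rcases eq_or_ne b k with rfl | hk
    · simp [hi]
    · simp [hi, hk, swap_apply_of_ne_of_ne]

theorem pencil_mul_swap (σ : Perm ι) (i k : ι) :
    pencil (σ * swap i k) = pencil σ *
      (1 + Matrix.vecMulVec ((permResolvent σ - 1) *ᵥ rootVec i k) (rootVec i k)) := by
  have h : pencil σ * (permResolvent σ - 1) = (X : ℚ⟦X⟧) • permSeries σ := by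
    rw [mul_sub, pencil_mul_resolvent, mul_one, pencil, sub_sub_cancel]
  rw [mul_add, mul_one, Matrix.mul_vecMulVec, Matrix.mulVec_mulVec, h, pencil, pencil,
    permSeries_mul_swap, smul_sub, Matrix.smul_mulVec, Matrix.smul_vecMulVec]
  abel

theorem rootVec_dotProduct (i k : ι) (v : ι → ℚ⟦X⟧) : rootVec i k ⬝ᵥ v = v i - v k := by
  simp [rootVec, sub_dotProduct]

theorem mulVec_rootVec (i k : ι) (M : Matrix ι ι ℚ⟦X⟧) (a : ι) :
    (M *ᵥ rootVec i k) a = M a i - M a k := by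
  simp [rootVec, Matrix.mulVec_sub]

theorem det_pencil_mul_swap (σ : Perm ι) {i k : ι} (hik : i ≠ k) :
    (pencil (σ * swap i k)).det = (pencil σ).det *
      (permResolvent σ i i + permResolvent σ k k - permResolvent σ i k - permResolvent σ k i
        - 1) := by
  rw [pencil_mul_swap, Matrix.det_mul, Matrix.det_one_add_vecMulVec, rootVec_dotProduct,
    mulVec_rootVec, mulVec_rootVec]
  simp only [Matrix.sub_apply, Matrix.one_apply_eq, Matrix.one_apply_ne hik,
    Matrix.one_apply_ne hik.symm]
  ring

theorem det_mul_resolvent_mul_swap (σ : Perm ι) {i k : ι} (hik : i ≠ k) :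
    (pencil (σ * swap i k)).det * permResolvent (σ * swap i k) k k = (pencil σ).det *
      (permResolvent σ k k * permResolvent σ i i - permResolvent σ k i * permResolvent σ i k
        - permResolvent σ i k) := by
  set u := rootVec i k with hu
  set v := (permResolvent σ - 1) *ᵥ u with hv
  set s := u ⬝ᵥ v with hs
  have hdet : (pencil (σ * swap i k)).det = (pencil σ).det * (1 + s) := by
    rw [pencil_mul_swap, Matrix.det_mul, Matrix.det_one_add_vecMulVec]
  have h1 : (1 + Matrix.vecMulVec v u) * ((1 + s) • (1 : Matrix ι ι ℚ⟦X⟧) - Matrix.vecMulVec v u) =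
      (1 + s) • 1 := by
    rw [mul_sub, add_mul, add_mul, one_mul, one_mul, Matrix.vecMulVec_mul_vecMulVec, ← hs]
    rw [Matrix.mul_smul, mul_one, add_smul, one_smul, Matrix.vecMulVec_smul, add_smul, one_smul]
    abel
  have h2 : (pencil (σ * swap i k)) *
      (((1 + s) • (1 : Matrix ι ι ℚ⟦X⟧) - Matrix.vecMulVec v u) * permResolvent σ) =
        (1 + s) • 1 := by
    rw [pencil_mul_swap, ← hu, ← hv, mul_assoc, ← mul_assoc (1 + Matrix.vecMulVec v u), h1,
      Matrix.smul_mul, one_mul, Matrix.mul_smul, pencil_mul_resolvent]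
  have h3 : ((1 + s) • (1 : Matrix ι ι ℚ⟦X⟧) - Matrix.vecMulVec v u) * permResolvent σ =
      (1 + s) • permResolvent (σ * swap i k) := by
    have h := congrArg (permResolvent (σ * swap i k) * ·) h2
    simp only [← mul_assoc, resolvent_mul_pencil, one_mul] at h
    rw [h, Matrix.mul_smul, mul_one]
  have h4 := congrFun (congrFun h3 k) k
  rw [sub_mul, Matrix.smul_mul, one_mul, Matrix.vecMulVec_mul] at h4
  simp only [Matrix.sub_apply, Matrix.smul_apply, smul_eq_mul, Matrix.vecMulVec_apply] at h4
  have hvi : v i = permResolvent σ i i - permResolvent σ i k - 1 := by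
    rw [hv, hu, mulVec_rootVec]; simp [hik]; ring
  have hvk : v k = permResolvent σ k i - permResolvent σ k k + 1 := by
    rw [hv, hu, mulVec_rootVec]; simp [hik.symm]; ring
  have huk : (u ᵥ* permResolvent σ) k = permResolvent σ i k - permResolvent σ k k := by
    simp [hu, rootVec, Matrix.sub_vecMul]
  have hs' : s = v i - v k := rootVec_dotProduct _ _ _
  rw [hdet, mul_assoc, ← h4, huk, hs', hvi, hvk]
  ring

/-- The Euler derivation `X d/dX`. -/
noncomputable def eulerDer : Derivation ℚ ℚ⟦X⟧ ℚ⟦X⟧ := (X : ℚ⟦X⟧) • derivative ℚ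

theorem eulerDer_apply (f : ℚ⟦X⟧) : eulerDer f = X * d⁄dX ℚ f := rfl

theorem coeff_eulerDer (f : ℚ⟦X⟧) (r : ℕ) : coeff r (eulerDer f) = r * coeff r f := by
  rw [eulerDer_apply]
  cases r with
  | zero => simp
  | succ r => rw [coeff_succ_X_mul, coeff_derivative]; push_cast; ring

/-- The geometric series `1 / (1 - X)`. -/
noncomputable def geom : ℚ⟦X⟧ := (1 - X)⁻¹

theorem one_sub_X_mul_geom : (1 - X) * geom = 1 :=
  PowerSeries.mul_inv_cancel _ (by simp)

theorem X_mul_geom : X * geom = geom - 1 := by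
  linear_combination -one_sub_X_mul_geom

theorem eulerDer_geom : eulerDer geom = geom * (geom - 1) := by
  have h := congrArg eulerDer one_sub_X_mul_geom
  have hX : eulerDer (1 - X) = -X := by simp [eulerDer_apply]
  rw [Derivation.leibniz, hX, Derivation.map_one_eq_zero, smul_eq_mul, smul_eq_mul] at h
  linear_combination geom * h - eulerDer geom * one_sub_X_mul_geom + geom * X_mul_geom

theorem eulerDer_geom_pow (e : ℕ) : eulerDer (geom ^ e) = e * geom ^ e * (geom - 1) := by
  induction e with
  | zero => simp
  | succ e ih =>
    rw [pow_succ, Derivation.leibniz, ih, eulerDer_geom, smul_eq_mul, smul_eq_mul]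
    push_cast
    ring

theorem pencil_map_eulerDer {κ : Type*} [DecidableEq κ] (σ : Perm κ) :
    (pencil σ).map eulerDer = pencil σ - 1 := by
  ext1 i j
  have h1 : eulerDer ((1 : Matrix κ κ ℚ⟦X⟧) i j) = 0 := by
    rw [Matrix.one_apply]; split_ifs <;> simp
  have h2 : eulerDer (X * permSeries σ i j) = X * permSeries σ i j := by
    simp only [permSeries, Matrix.of_apply]
    split_ifs <;> simp [eulerDer_apply]
  simp only [pencil, Matrix.map_apply, Matrix.sub_apply, Matrix.smul_apply, smul_eq_mul, map_sub,
    h1, h2]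
  ring

theorem eulerDer_det_pencil (σ : Perm ι) :
    eulerDer (pencil σ).det =
      (pencil σ).det * (Fintype.card ι - (permResolvent σ).trace) := by
  have h : (pencil σ).adjugate = (pencil σ).det • permResolvent σ := by
    rw [← mul_one (pencil σ).adjugate, ← pencil_mul_resolvent σ, ← mul_assoc,
      Matrix.adjugate_mul, Matrix.smul_mul, one_mul]
  rw [Derivation.map_det_eq_trace, pencil_map_eulerDer, h, Matrix.smul_mul, mul_sub,
    resolvent_mul_pencil, mul_one, Matrix.trace_smul, Matrix.trace_sub, Matrix.trace_one,
    smul_eq_mul]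

theorem Derivation.map_matrix_mul {R A κ : Type*} [CommRing R] [CommRing A] [Algebra R A]
    [Fintype κ] (D : Derivation R A A) (M N : Matrix κ κ A) :
    (M * N).map D = M.map D * N + M * N.map D := by
  ext1 i j
  simp only [Matrix.map_apply, Matrix.mul_apply, map_sum, Matrix.add_apply,
    ← Finset.sum_add_distrib]
  refine Finset.sum_congr rfl fun k _ => ?_
  rw [D.leibniz, smul_eq_mul, smul_eq_mul]
  ring

theorem permResolvent_map_eulerDer (σ : Perm ι) :
    (permResolvent σ).map eulerDer = permResolvent σ * permResolvent σ - permResolvent σ := by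
  have h := congrArg (fun M => M.map eulerDer) (pencil_mul_resolvent σ)
  have h1 : (1 : Matrix ι ι ℚ⟦X⟧).map eulerDer = 0 := by
    ext1 i j
    rw [Matrix.map_apply, Matrix.one_apply]; split_ifs <;> simp
  simp only [Derivation.map_matrix_mul, pencil_map_eulerDer, h1] at h
  have h2 := congrArg (permResolvent σ * ·) h
  simp only [mul_add, ← mul_assoc, resolvent_mul_pencil, one_mul, mul_zero, mul_sub, sub_mul] at h2
  rw [eq_sub_iff_add_eq, ← sub_eq_zero, ← h2]
  abel

theorem eulerDer_resolvent_apply (σ : Perm ι) (k : ι) :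
    eulerDer (permResolvent σ k k) =
      (permResolvent σ * permResolvent σ) k k - permResolvent σ k k :=
  congrFun (congrFun (permResolvent_map_eulerDer σ) k) k

theorem resolvent_mulVec_eq_geom (σ : Perm ι) (v : ι → ℚ⟦X⟧) (h : permSeries σ *ᵥ v = v) :
    permResolvent σ *ᵥ v = geom • v := by
  have h1 : pencil σ *ᵥ v = (1 - X : ℚ⟦X⟧) • v := by
    rw [pencil, Matrix.sub_mulVec, Matrix.one_mulVec, Matrix.smul_mulVec, h, sub_smul, one_smul]
  have h2 : pencil σ *ᵥ (geom • v) = v := by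
    rw [Matrix.mulVec_smul, h1, smul_smul, mul_comm, one_sub_X_mul_geom, one_smul]
  rw [← h2, Matrix.mulVec_mulVec, resolvent_mul_pencil, Matrix.one_mulVec, h2]

theorem vecMul_resolvent_eq_geom (σ : Perm ι) (v : ι → ℚ⟦X⟧) (h : v ᵥ* permSeries σ = v) :
    v ᵥ* permResolvent σ = geom • v := by
  have h1 : v ᵥ* pencil σ = (1 - X : ℚ⟦X⟧) • v := by
    rw [pencil, Matrix.vecMul_sub, Matrix.vecMul_one, Matrix.vecMul_smul, h, sub_smul, one_smul]
  have h2 : (geom • v) ᵥ* pencil σ = v := by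
    rw [Matrix.smul_vecMul, h1, smul_smul, mul_comm, one_sub_X_mul_geom, one_smul]
  rw [← h2, Matrix.vecMul_vecMul, pencil_mul_resolvent, Matrix.vecMul_one, h2]

theorem sum_resolvent_row (σ : Perm ι) (k : ι) : ∑ i, permResolvent σ k i = geom := by
  have h := congrFun (resolvent_mulVec_eq_geom σ 1 (by
    ext1 i
    simp [Matrix.mulVec, dotProduct, permSeries, ← Equiv.symm_apply_eq])) k
  simpa [Matrix.mulVec, dotProduct] using h

theorem sum_resolvent_col (σ : Perm ι) (k : ι) : ∑ i, permResolvent σ i k = geom := by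
  have h := congrFun (vecMul_resolvent_eq_geom σ 1 (by
    ext1 i
    simp [Matrix.vecMul, dotProduct, permSeries])) k
  simpa [Matrix.vecMul, dotProduct] using h

theorem resolvent_apply_of_fixed (σ : Perm ι) {j : ι} (hj : σ j = j) (i : ι) :
    permResolvent σ i j = if i = j then geom else 0 := by
  have h := congrFun (resolvent_mulVec_eq_geom σ (Pi.single j 1) (by
    ext1 i
    simp [permSeries, hj, Pi.single_apply])) i
  simpa [Pi.single_apply] using h

theorem resolvent_apply_of_fixed_left (σ : Perm ι) {j : ι} (hj : σ j = j) (i : ι) :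
    permResolvent σ j i = if i = j then geom else 0 := by
  have h := congrFun (vecMul_resolvent_eq_geom σ (Pi.single j 1) (by
    ext1 i
    have : j = σ i ↔ i = j := by
      rw [eq_comm, ← hj, σ.injective.eq_iff, hj]
    simp [permSeries, Pi.single_apply, this])) i
  simpa [Pi.single_apply] using h

end Pencil

section JucysMurphy

variable {N : ℕ}

theorem Fin.sum_Iio_eq {A : Type*} [CommRing A] (k : Fin N) (f : Fin N → A) (c : A)
    (hf : ∀ j, k < j → f j = c) :
    ∑ i ∈ Finset.Iio k, f i = ∑ i, f i - f k - ((N : A) - 1 - (k : ℕ)) * c := by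
  have h1 : ∑ i, f i = ∑ i ∈ Finset.Iic k, f i + ∑ i ∈ Finset.Ioi k, f i := by
    rw [← Finset.sum_union]
    · congr 1
      ext i
      simp [le_or_gt]
    · rw [Finset.disjoint_left]
      intro i hi hj
      exact absurd (Finset.mem_Iic.mp hi) (not_le.mpr (Finset.mem_Ioi.mp hj))
  have h2 : ∑ i ∈ Finset.Ioi k, f i = ((N : A) - 1 - (k : ℕ)) * c := by
    rw [Finset.sum_congr rfl fun i hi => hf i (Finset.mem_Ioi.mp hi), Finset.sum_const,
      Fin.card_Ioi, nsmul_eq_mul,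
      Nat.cast_sub (show (k : ℕ) ≤ N - 1 from Nat.le_sub_one_of_lt k.isLt),
      Nat.cast_sub (show 1 ≤ N from k.pos), Nat.cast_one]
  rw [h1, h2, ← Finset.Iio_insert, Finset.sum_insert (by simp)]
  ring

/-- The generating function `∏ (1 - X ^ λᵢ) / (1 - X)` of the hook characters of the symmetric
group on the first `d` letters, on a permutation fixing the other ones. -/
noncomputable def hookSeries (d : ℕ) (σ : Perm (Fin N)) : ℚ⟦X⟧ :=
  (pencil σ).det * geom ^ (N + 1 - d)

/-- The companion functional of `hookSeries` with respect to the letter `k`. -/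
noncomputable def hookSeriesAt (k : Fin N) (σ : Perm (Fin N)) : ℚ⟦X⟧ :=
  hookSeries (k + 1) σ * (((k : ℕ) + 1) * permResolvent σ k k - geom)

theorem eulerDer_hookSeries (d : ℕ) (hd : d ≤ N + 1) (σ : Perm (Fin N)) :
    eulerDer (hookSeries d σ) = hookSeries d σ *
      (N - (permResolvent σ).trace + ((N : ℚ⟦X⟧) + 1 - d) * (geom - 1)) := by
  rw [hookSeries, Derivation.leibniz, eulerDer_geom_pow, eulerDer_det_pencil, Fintype.card_fin,
    Nat.cast_sub hd, smul_eq_mul, smul_eq_mul]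
  push_cast
  ring

theorem sum_resolvent_diag_Iio (k : Fin N) (σ : Perm (Fin N)) (hσ : ∀ j, k < j → σ j = j) :
    ∑ i ∈ Finset.Iio k, permResolvent σ i i =
      (permResolvent σ).trace - permResolvent σ k k - ((N : ℚ⟦X⟧) - 1 - (k : ℕ)) * geom :=
  Fin.sum_Iio_eq k _ _ fun j hj => by simp [resolvent_apply_of_fixed σ (hσ j hj)]

theorem sum_resolvent_row_Iio (k : Fin N) (σ : Perm (Fin N)) (hσ : ∀ j, k < j → σ j = j) :
    ∑ i ∈ Finset.Iio k, permResolvent σ k i = geom - permResolvent σ k k := by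
  rw [Fin.sum_Iio_eq k _ 0 fun j hj => by simp [resolvent_apply_of_fixed σ (hσ j hj), hj.ne],
    sum_resolvent_row]
  ring

theorem sum_resolvent_col_Iio (k : Fin N) (σ : Perm (Fin N)) (hσ : ∀ j, k < j → σ j = j) :
    ∑ i ∈ Finset.Iio k, permResolvent σ i k = geom - permResolvent σ k k := by
  rw [Fin.sum_Iio_eq k _ 0 fun j hj => by
      simp [resolvent_apply_of_fixed_left σ (hσ j hj), hj.ne],
    sum_resolvent_col]
  ring

theorem sum_resolvent_mul_Iio (k : Fin N) (σ : Perm (Fin N)) (hσ : ∀ j, k < j → σ j = j) :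
    ∑ i ∈ Finset.Iio k, permResolvent σ k i * permResolvent σ i k =
      (permResolvent σ * permResolvent σ) k k - permResolvent σ k k * permResolvent σ k k := by
  rw [Fin.sum_Iio_eq k _ 0 fun j hj => by
      simp [resolvent_apply_of_fixed_left σ (hσ j hj), hj.ne], Matrix.mul_apply]
  ring

/-- The action of a Jucys–Murphy element on `hookSeries`. -/
theorem sum_hookSeries_mul_swap (k : Fin N) (σ : Perm (Fin N)) (hσ : ∀ j, k < j → σ j = j) :
    ∑ i ∈ Finset.Iio k, hookSeries (k + 1) (σ * swap i k) =
      hookSeriesAt k σ - eulerDer (hookSeries (k + 1) σ) := by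
  have h : ∀ i ∈ Finset.Iio k, hookSeries (k + 1) (σ * swap i k) = hookSeries (k + 1) σ *
      (permResolvent σ i i + permResolvent σ k k - permResolvent σ i k - permResolvent σ k i
        - 1) := by
    intro i hi
    rw [hookSeries, det_pencil_mul_swap σ (Finset.mem_Iio.mp hi).ne, hookSeries]
    ring
  rw [Finset.sum_congr rfl h, ← Finset.mul_sum]
  simp only [Finset.sum_sub_distrib, Finset.sum_add_distrib, sum_resolvent_diag_Iio k σ hσ,
    sum_resolvent_row_Iio k σ hσ, sum_resolvent_col_Iio k σ hσ, Finset.sum_const, Fin.card_Iio,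
    nsmul_eq_mul]
  rw [eulerDer_hookSeries _ (by omega), hookSeriesAt]
  push_cast
  ring

/-- The action of a Jucys–Murphy element on `hookSeriesAt`. -/
theorem sum_hookSeriesAt_mul_swap (k : Fin N) (σ : Perm (Fin N)) (hσ : ∀ j, k < j → σ j = j) :
    ∑ i ∈ Finset.Iio k, hookSeriesAt k (σ * swap i k) =
      (k : ℕ) * hookSeriesAt k σ - eulerDer (hookSeriesAt k σ) := by
  have h : ∀ i ∈ Finset.Iio k, hookSeriesAt k (σ * swap i k) =
      hookSeries (k + 1) σ * (((k : ℕ) + 1) *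
        (permResolvent σ k k * permResolvent σ i i - permResolvent σ k i * permResolvent σ i k
        - permResolvent σ i k)) - geom * hookSeries (k + 1) (σ * swap i k) := by
    intro i hi
    have h1 := det_mul_resolvent_mul_swap σ (Finset.mem_Iio.mp hi).ne
    rw [hookSeriesAt, hookSeries, hookSeries]
    linear_combination geom ^ (N + 1 - ((k : ℕ) + 1)) * ((k : ℕ) + 1) * h1
  rw [Finset.sum_congr rfl h, Finset.sum_sub_distrib, ← Finset.mul_sum, ← Finset.mul_sum,
    ← Finset.mul_sum, sum_hookSeries_mul_swap k σ hσ]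
  simp only [Finset.sum_sub_distrib, sum_resolvent_mul_Iio k σ hσ, sum_resolvent_col_Iio k σ hσ,
    ← Finset.mul_sum, sum_resolvent_diag_Iio k σ hσ]
  have h2 : eulerDer ((((k : ℕ) : ℚ⟦X⟧) + 1) * permResolvent σ k k - geom) =
      (((k : ℕ) : ℚ⟦X⟧) + 1) * ((permResolvent σ * permResolvent σ) k k - permResolvent σ k k)
        - geom * (geom - 1) := by
    rw [map_sub, Derivation.leibniz, eulerDer_resolvent_apply, eulerDer_geom]
    simp
  rw [hookSeriesAt, Derivation.leibniz, h2, eulerDer_hookSeries _ (by omega), smul_eq_mul,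
    smul_eq_mul]
  push_cast
  ring

theorem hookSeries_succ (k : Fin N) (σ : Perm (Fin N)) :
    hookSeries (k + 1) σ = (1 - X) * hookSeries k σ := by
  have h : N + 1 - (k : ℕ) = N + 1 - (k + 1) + 1 := by omega
  rw [hookSeries, hookSeries, h, pow_succ]
  linear_combination (-(pencil σ).det * geom ^ (N + 1 - ((k : ℕ) + 1))) * one_sub_X_mul_geom

theorem hookSeriesAt_of_fixed (k : Fin N) (σ : Perm (Fin N)) (hσ : σ k = k) :
    hookSeriesAt k σ = (k : ℕ) * hookSeries k σ := by
  rw [hookSeriesAt, hookSeries_succ, resolvent_apply_of_fixed σ hσ, if_pos rfl]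
  linear_combination ((k : ℕ) * hookSeries k σ) * one_sub_X_mul_geom

end JucysMurphy

section Evaluation

theorem coeff_mul_geom (f : ℚ⟦X⟧) (r : ℕ) :
    coeff r (f * geom) = ∑ j ∈ Finset.range (r + 1), coeff j f := by
  have h : geom = mk 1 := by
    have h1 : (mk (1 : ℕ → ℚ)) * (1 - X) = 1 := mk_one_mul_one_sub_eq_one ℚ
    linear_combination (mk (1 : ℕ → ℚ)) * one_sub_X_mul_geom - geom * h1
  rw [coeff_mul, Finset.Nat.sum_antidiagonal_eq_sum_range_succ_mk, h]
  simp

theorem sum_range_sum_range_succ (c : ℕ → ℚ) (n : ℕ) :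
    ∑ r ∈ Finset.range n, ∑ j ∈ Finset.range (r + 1), c j =
      ∑ j ∈ Finset.range (n + 1), ((n : ℚ) - j) * c j := by
  induction n with
  | zero => simp
  | succ n ih =>
    rw [Finset.sum_range_succ, ih, Finset.sum_range_succ _ (n + 1), ← Finset.sum_add_distrib]
    push_cast
    rw [sub_self, zero_mul, add_zero]
    refine Finset.sum_congr rfl fun j _ => ?_
    ring

theorem sum_coeff_mul_geom (p : Polynomial ℚ) (n : ℕ) (hp : p.natDegree ≤ n) :
    ∑ r ∈ Finset.range n, coeff r ((p : ℚ⟦X⟧) * geom) =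
      n * p.eval 1 - p.derivative.eval 1 := by
  simp_rw [coeff_mul_geom, Polynomial.coeff_coe]
  rw [sum_range_sum_range_succ, Polynomial.eval_eq_sum_range' (Nat.lt_succ_of_le hp),
    Polynomial.derivative_eval, Polynomial.sum_over_range' _ (by simp) (n + 1) (by omega),
    Finset.mul_sum, ← Finset.sum_sub_distrib]
  refine Finset.sum_congr rfl fun j _ => ?_
  simp
  ring

variable {ι : Type*} [DecidableEq ι]

/-- The permutation matrix of `σ`, with rational entries. -/
def permRat (σ : Perm ι) : Matrix ι ι ℚ := Matrix.of fun i j => if i = σ j then 1 else 0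

variable [Fintype ι]

theorem permRat_mul (σ τ : Perm ι) : permRat (σ * τ) = permRat σ * permRat τ := by
  ext1 i j
  simp only [permRat, Matrix.mul_apply, Matrix.of_apply, Perm.mul_apply, mul_ite, mul_one,
    mul_zero, Finset.sum_ite_eq', Finset.mem_univ, if_true]
  rfl

theorem permRat_pow (σ : Perm ι) (n : ℕ) : permRat σ ^ n = permRat (σ ^ n) := by
  induction n with
  | zero =>
    ext1 i j
    simp [permRat, Matrix.one_apply]
  | succ n ih => rw [pow_succ, ih, pow_succ, permRat_mul]

theorem det_pencil_eq_charpolyRev (σ : Perm ι) :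
    (pencil σ).det = ((permRat σ).charpolyRev : ℚ⟦X⟧) := by
  rw [Matrix.charpolyRev, ← Polynomial.coeToPowerSeries.ringHom_apply, RingHom.map_det]
  congr 1
  ext1 i j
  simp only [pencil, permSeries, permRat, RingHom.mapMatrix_apply, Matrix.map_apply,
    Matrix.sub_apply, Matrix.smul_apply, Matrix.of_apply, map_sub, smul_eq_mul, map_mul,
    Matrix.one_apply]
  split_ifs <;> simp

theorem natDegree_charpolyRev_le (M : Matrix ι ι ℚ) :
    M.charpolyRev.natDegree ≤ Fintype.card ι := by
  rw [← Matrix.reverse_charpoly, ← M.charpoly_natDegree_eq_dim]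
  exact Polynomial.reverse_natDegree_le _

theorem charpoly_permRat_of_sameCycle (σ : Perm ι) (a : ι) (h : ∀ i j, σ.SameCycle i j) :
    (permRat σ).charpoly = Polynomial.X ^ Fintype.card ι - 1 := by
  have hc : σ.IsCycleOn (Finset.univ : Finset ι) := by
    rw [Finset.coe_univ]
    exact ⟨Set.bijOn_univ.mpr σ.bijective, fun i _ j _ => h i j⟩
  have hpow : σ ^ Fintype.card ι = 1 := by
    ext i
    exact hc.pow_card_apply (Finset.mem_univ i)
  have hcard : 0 < Fintype.card ι := Fintype.card_pos_iff.mpr ⟨a⟩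
  set q := (permRat σ).charpoly - (Polynomial.X ^ Fintype.card ι - 1) with hq
  have hdeg : q.natDegree < Fintype.card ι := by
    have hm : (Polynomial.X ^ Fintype.card ι - 1 : Polynomial ℚ).Monic :=
      Polynomial.monic_X_pow_sub_C 1 hcard.ne'
    have hX : (Polynomial.X ^ Fintype.card ι - 1 : Polynomial ℚ).natDegree = Fintype.card ι :=
      Polynomial.natDegree_X_pow_sub_C (r := 1)
    have hd := (permRat σ).charpoly_natDegree_eq_dim
    rcases eq_or_ne q 0 with h0 | h0
    · rwa [h0, Polynomial.natDegree_zero]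
    rw [Polynomial.natDegree_lt_iff_degree_lt h0, ← hd,
      ← Polynomial.degree_eq_natDegree (permRat σ).charpoly_monic.ne_zero]
    refine Polynomial.degree_sub_lt_left ?_ (permRat σ).charpoly_monic.ne_zero ?_
    · rw [Polynomial.degree_eq_natDegree hm.ne_zero, hX,
        Polynomial.degree_eq_natDegree (permRat σ).charpoly_monic.ne_zero, hd]
    · rw [hm.leadingCoeff, (permRat σ).charpoly_monic.leadingCoeff]
  have hzero : Polynomial.aeval (permRat σ) q = 0 := by
    rw [hq, map_sub, Matrix.aeval_self_charpoly, map_sub, map_pow, Polynomial.aeval_X, map_one,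
      permRat_pow, hpow, ← pow_zero σ, ← permRat_pow, pow_zero, sub_self, sub_zero]
  suffices q = 0 from sub_eq_zero.mp this
  ext j
  rw [Polynomial.coeff_zero]
  rcases lt_or_ge j (Fintype.card ι) with hj | hj
  · have h1 := congrFun (congrFun hzero ((σ ^ j) a)) a
    rw [Polynomial.aeval_eq_sum_range' hdeg, Matrix.sum_apply,
      Finset.sum_eq_single_of_mem j (Finset.mem_range.mpr hj)] at h1
    · rw [Matrix.smul_apply, permRat_pow, permRat, Matrix.of_apply, if_pos rfl] at h1
      simpa using h1
    · intro k hk hkj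
      have h2 : (σ ^ j) a ≠ (σ ^ k) a := by
        rw [Ne, hc.pow_apply_eq_pow_apply (Finset.mem_univ a), Finset.card_univ]
        intro h3
        exact hkj (Nat.ModEq.eq_of_lt_of_lt h3 hj (Finset.mem_range.mp hk)).symm
      rw [Matrix.smul_apply, permRat_pow, permRat, Matrix.of_apply, if_neg h2, smul_zero]
  · exact Polynomial.coeff_eq_zero_of_natDegree_lt (hdeg.trans_le hj)

theorem charpolyRev_permRat_of_sameCycle (σ : Perm ι) (a : ι) (h : ∀ i j, σ.SameCycle i j) :
    (permRat σ).charpolyRev = 1 - Polynomial.X ^ Fintype.card ι := by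
  have hcard : 0 < Fintype.card ι := Fintype.card_pos_iff.mpr ⟨a⟩
  have hd := (permRat σ).charpoly_natDegree_eq_dim
  ext n
  rw [← Matrix.reverse_charpoly, Polynomial.coeff_reverse, hd,
    charpoly_permRat_of_sameCycle σ a h]
  rcases le_or_gt n (Fintype.card ι) with hn | hn
  · rw [Polynomial.revAt_le hn]
    simp only [Polynomial.coeff_sub, Polynomial.coeff_X_pow, Polynomial.coeff_one]
    split_ifs <;> first | omega | norm_num
  · rw [Polynomial.revAt_eq_self_of_lt hn]
    simp only [Polynomial.coeff_sub, Polynomial.coeff_X_pow, Polynomial.coeff_one]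
    split_ifs <;> first | omega | norm_num

theorem eval_one_charpolyRev_permRat (σ : Perm ι) (a : ι) : (permRat σ).charpolyRev.eval 1 = 0 := by
  rw [Matrix.charpolyRev, ← Polynomial.coe_evalRingHom, RingHom.map_det,
    ← Matrix.exists_vecMul_eq_zero_iff]
  refine ⟨1, fun h => one_ne_zero (congrFun h a), ?_⟩
  ext1 j
  have h1 : ∀ i, (1 - (Polynomial.X : Polynomial ℚ) • (permRat σ).map Polynomial.C) i j =
      (if i = j then 1 else 0) - (if i = σ j then Polynomial.X else 0) := by
    intro i
    simp only [permRat, Matrix.sub_apply, Matrix.smul_apply, Matrix.map_apply, Matrix.of_apply,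
      Matrix.one_apply]
    split_ifs <;> simp
  simp [Matrix.vecMul, dotProduct, h1, apply_ite (Polynomial.eval (1 : ℚ))]

theorem eval_one_derivative_charpolyRev_permRat (σ : Perm ι) {a b : ι} (h : ¬ σ.SameCycle a b) :
    (permRat σ).charpolyRev.derivative.eval 1 = 0 := by
  have hD : (permRat σ).charpolyRev.derivative =
      Polynomial.derivative' (R := ℚ) (permRat σ).charpolyRev := rfl
  rw [hD, Matrix.charpolyRev, Derivation.map_det, ← Polynomial.coe_evalRingHom, map_sum]
  refine Finset.sum_eq_zero fun i _ => ?_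
  obtain ⟨c, hc⟩ : ∃ c, ¬ σ.SameCycle c i := by
    by_contra! hall
    exact h ((hall a).trans (hall b).symm)
  rw [RingHom.map_det, ← Matrix.exists_vecMul_eq_zero_iff]
  refine ⟨fun j => if σ.SameCycle c j then 1 else 0, fun h0 => ?_, ?_⟩
  · have := congrFun h0 c
    simp [Equiv.Perm.SameCycle.refl σ c] at this
  · ext1 j
    rw [Matrix.vecMul, dotProduct]
    simp only [RingHom.mapMatrix_apply, Matrix.map_apply, Matrix.updateCol_apply,
      Matrix.sub_apply, Matrix.smul_apply, permRat, Matrix.of_apply, Matrix.one_apply,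
      Polynomial.coe_evalRingHom, Pi.zero_apply]
    have hv : ∀ l, (if σ.SameCycle c (σ l) then (1 : ℚ) else 0) =
        if σ.SameCycle c l then 1 else 0 := fun l => by
      simp only [Perm.sameCycle_apply_right]
    split_ifs with hji
    · subst hji
      rw [Finset.sum_eq_single (σ j)]
      · rw [hv, if_neg hc, zero_mul]
      · intro l _ hl
        split_ifs <;> simp
      · simp
    · have hs : ∀ x, (if σ.SameCycle c x then (1 : ℚ) else 0) * Polynomial.eval 1
          ((if x = j then 1 else 0) - (Polynomial.X : Polynomial ℚ) •
            Polynomial.C (if x = σ j then 1 else 0)) =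
          (if x = j then (if σ.SameCycle c x then (1 : ℚ) else 0) else 0) -
            (if x = σ j then (if σ.SameCycle c x then (1 : ℚ) else 0) else 0) := by
        intro x
        split_ifs <;> simp
      rw [Finset.sum_congr rfl fun x _ => hs x, Finset.sum_sub_distrib, Finset.sum_ite_eq',
        Finset.sum_ite_eq', if_pos (Finset.mem_univ _), if_pos (Finset.mem_univ _), hv, sub_self]

theorem sum_coeff_hookSeries {N : ℕ} (hN : 0 < N) (σ : Perm (Fin N)) :
    ∑ r ∈ Finset.range N, coeff r (hookSeries N σ) =
      if ∀ i j, σ.SameCycle i j then (N : ℚ) else 0 := by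
  have hdeg := natDegree_charpolyRev_le (permRat σ)
  rw [Fintype.card_fin] at hdeg
  rw [hookSeries, Nat.add_sub_cancel_left, pow_one, det_pencil_eq_charpolyRev,
    sum_coeff_mul_geom _ _ hdeg, eval_one_charpolyRev_permRat σ ⟨0, hN⟩]
  split_ifs with h
  · rw [charpolyRev_permRat_of_sameCycle σ ⟨0, hN⟩ h]
    simp [Polynomial.derivative_X_pow]
  · push Not at h
    obtain ⟨i, j, hij⟩ := h
    rw [eval_one_derivative_charpolyRev_permRat σ hij]
    simp

theorem cycleType_eq_finRotate_iff {N : ℕ} (hN : 0 < N) (σ : Perm (Fin N)) :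
    σ.cycleType = (finRotate N).cycleType ↔ ∀ i j, σ.SameCycle i j := by
  obtain rfl | hN2 : N = 1 ∨ 2 ≤ N := by omega
  · refine iff_of_true (by rw [Subsingleton.elim σ (finRotate 1)]) fun i j => ?_
    rw [Subsingleton.elim i j]
  have : Nontrivial (Fin N) := Fin.nontrivial_iff_two_le.mpr hN2
  rw [cycleType_finRotate_of_le hN2]
  constructor
  · intro h
    have hc : σ.IsCycle := by
      rw [← Perm.card_cycleType_eq_one, h, Multiset.card_singleton]
    have hs : σ.support = Finset.univ := by
      rw [← Finset.card_eq_iff_eq_univ, Fintype.card_fin, ← Perm.sum_cycleType, h,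
        Multiset.sum_singleton]
    have hne : ∀ i, σ i ≠ i := fun i => Perm.mem_support.mp (hs ▸ Finset.mem_univ i)
    exact fun i j => hc.sameCycle (hne i) (hne j)
  · intro h
    have hne : ∀ i, σ i ≠ i := fun i hi => by
      obtain ⟨j, hj⟩ := exists_ne i
      exact hj (((h i j).eq_of_left hi).symm)
    have hc : σ.IsCycle := ⟨⟨0, hN⟩, hne _, fun j _ => h _ j⟩
    have hs : σ.support = Finset.univ :=
      Finset.eq_univ_of_forall fun i => Perm.mem_support.mpr (hne i)
    rw [hc.cycleType, hs, Finset.card_univ, Fintype.card_fin]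

end Evaluation

section MonotoneTuples

variable {α A : Type*} [Fintype α] [AddCommMonoid A]

/-- The `m`-tuples of letters satisfying `p`, with weakly increasing keys, all less than `k`. -/
noncomputable def monoTuples (p : α → Prop) (key : α → ℕ) (k m : ℕ) : Finset (Fin m → α) :=
  {f | (∀ i, p (f i)) ∧ (∀ i j, i ≤ j → key (f i) ≤ key (f j)) ∧ ∀ i, key (f i) < k}

theorem mem_monoTuples {p : α → Prop} {key : α → ℕ} {k m : ℕ} {f : Fin m → α} :
    f ∈ monoTuples p key k m ↔
      (∀ i, p (f i)) ∧ (∀ i j, i ≤ j → key (f i) ≤ key (f j)) ∧ ∀ i, key (f i) < k := by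
  simp [monoTuples]

theorem snoc_mem_monoTuples {p : α → Prop} {key : α → ℕ} {k m : ℕ} {f : Fin m → α} {a : α} :
    (Fin.snoc f a : Fin (m + 1) → α) ∈ monoTuples p key (k + 1) (m + 1) ∧ key a = k ↔
      f ∈ monoTuples p key (k + 1) m ∧ p a ∧ key a = k := by
  simp only [mem_monoTuples, Fin.forall_fin_succ', Fin.snoc_castSucc, Fin.snoc_last,
    Fin.castSucc_le_castSucc_iff]
  constructor
  · rintro ⟨⟨⟨h1, h2⟩, ⟨h3, -⟩, h4, -⟩, h5⟩
    exact ⟨⟨h1, fun i j => (h3 i).1 j, h4⟩, h2, h5⟩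
  · rintro ⟨⟨h1, h2, h3⟩, h4, h5⟩
    refine ⟨⟨⟨h1, h4⟩, ⟨fun i => ⟨fun j => h2 i j, fun _ => ?_⟩, fun j hj => ?_, fun _ => le_rfl⟩,
      h3, by omega⟩, h5⟩
    · have := h3 i
      omega
    · exact absurd hj (not_le.mpr (Fin.castSucc_lt_last j))

theorem sum_monoTuples_succ (p : α → Prop) (key : α → ℕ) (k m : ℕ) (F : (Fin (m + 1) → α) → A) :
    ∑ f ∈ monoTuples p key (k + 1) (m + 1), F f =
      ∑ f ∈ monoTuples p key k (m + 1), F f +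
        ∑ f ∈ monoTuples p key (k + 1) m,
          ∑ a with p a ∧ key a = k, F (Fin.snoc f a) := by
  rw [← Finset.sum_filter_add_sum_filter_not _ (fun f => key (f (Fin.last m)) < k)]
  congr 1
  · refine Finset.sum_congr ?_ fun _ _ => rfl
    ext f
    simp only [Finset.mem_filter, mem_monoTuples]
    constructor
    · rintro ⟨⟨h1, h2, -⟩, h4⟩
      exact ⟨h1, h2, fun i => (h2 i _ (Fin.le_last i)).trans_lt h4⟩
    · rintro ⟨h1, h2, h3⟩
      exact ⟨⟨h1, h2, fun i => (h3 i).trans (Nat.lt_succ_self k)⟩, h3 _⟩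
  · rw [← Finset.sum_product']
    symm
    refine Finset.sum_bij' (fun g _ => (Fin.snoc g.1 g.2 : Fin (m + 1) → α))
      (fun f _ => (Fin.init f, f (Fin.last m))) ?_ ?_ ?_ ?_ ?_
    · rintro ⟨f, a⟩ h
      simp only [Finset.mem_product, Finset.mem_filter, Finset.mem_univ, true_and] at h
      have h' := snoc_mem_monoTuples.mpr h
      simp only [Finset.mem_filter, Fin.snoc_last]
      exact ⟨h'.1, by omega⟩
    · intro f h
      simp only [Finset.mem_filter] at h
      have h1 := (mem_monoTuples.mp h.1).2.2 (Fin.last m)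
      simp only [Finset.mem_product, Finset.mem_filter, Finset.mem_univ, true_and]
      refine snoc_mem_monoTuples.mp ⟨?_, by omega⟩
      rw [Fin.snoc_init_self]
      exact h.1
    · rintro ⟨f, a⟩ _
      simp
    · intro f _
      simp
    · intro _ _
      rfl

theorem sum_monoTuples_zero (p : α → Prop) (key : α → ℕ) (k : ℕ) (F : (Fin 0 → α) → A) :
    ∑ f ∈ monoTuples p key k 0, F f = F Fin.elim0 := by
  have : monoTuples p key k 0 = {Fin.elim0} := by
    ext f
    simp [mem_monoTuples, Subsingleton.elim f Fin.elim0]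
  rw [this, Finset.sum_singleton]

theorem monoTuples_eq_empty (p : α → Prop) (key : α → ℕ) (k m : ℕ) (h : ∀ a, p a → k ≤ key a) :
    monoTuples p key k (m + 1) = ∅ := by
  refine Finset.eq_empty_of_forall_notMem fun f hf => ?_
  rw [mem_monoTuples] at hf
  exact absurd (hf.2.2 0) (not_lt.mpr (h _ (hf.1 0)))

end MonotoneTuples

section HookSums

variable {N : ℕ}

/-- The monotone `m`-tuples of transpositions of the first `k` letters. -/
noncomputable def swapTuples (N k m : ℕ) : Finset (Fin m → Fin N × Fin N) :=
  monoTuples (fun a => a.1 < a.2) (fun a => (a.2 : ℕ)) k m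

/-- The product of a tuple of transpositions. -/
def swapProd {m : ℕ} (f : Fin m → Fin N × Fin N) : Perm (Fin N) :=
  (List.ofFn fun i => swap (f i).1 (f i).2).prod

theorem swapProd_snoc {m : ℕ} (f : Fin m → Fin N × Fin N) (a : Fin N × Fin N) :
    swapProd (Fin.snoc f a : Fin (m + 1) → Fin N × Fin N) = swapProd f * swap a.1 a.2 := by
  rw [swapProd, List.ofFn_succ', List.concat_eq_append, List.prod_append]
  simp [swapProd]

theorem swapProd_apply_of_le {k m : ℕ} {f : Fin m → Fin N × Fin N} (hf : f ∈ swapTuples N k m)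
    {j : Fin N} (hj : k ≤ j) : swapProd f j = j := by
  have h := mem_monoTuples.mp hf
  have hmem : swapProd f ∈ MulAction.stabilizer (Perm (Fin N)) j := by
    refine Subgroup.list_prod_mem _ fun τ hτ => ?_
    obtain ⟨i, rfl⟩ := List.mem_ofFn.mp hτ
    have h1 := h.1 i
    have h2 := h.2.2 i
    simp only [Fin.lt_def] at h1
    exact swap_apply_of_ne_of_ne (Fin.ne_of_val_ne (by omega)) (Fin.ne_of_val_ne (by omega))
  exact hmem

theorem sum_swapTuples_succ {A : Type*} [AddCommMonoid A] (k : Fin N) (m : ℕ)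
    (F : Perm (Fin N) → A) :
    ∑ f ∈ swapTuples N (k + 1) (m + 1), F (swapProd f) =
      ∑ f ∈ swapTuples N k (m + 1), F (swapProd f) +
        ∑ f ∈ swapTuples N (k + 1) m, ∑ i ∈ Finset.Iio k, F (swapProd f * swap i k) := by
  rw [swapTuples, sum_monoTuples_succ]
  refine congrArg _ (Finset.sum_congr rfl fun f _ => ?_)
  symm
  refine Finset.sum_bij' (fun i _ => (i, k)) (fun a _ => a.1) ?_ ?_ ?_ ?_ ?_
  · intro i hi
    simpa using hi
  · rintro ⟨i, j⟩ h
    simp only [Finset.mem_filter, Finset.mem_univ, true_and, Fin.val_inj] at h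
    obtain ⟨h, rfl⟩ := h
    simpa using h
  · intro _ _
    rfl
  · rintro ⟨i, j⟩ h
    simp only [Finset.mem_filter, Finset.mem_univ, true_and, Fin.val_inj] at h
    simp [h.2]
  · intro i _
    rw [swapProd_snoc]

/-- The sum of `hookSeries` over monotone tuples of transpositions of the first `k` letters. -/
noncomputable def hookSum (N k m : ℕ) : ℚ⟦X⟧ :=
  ∑ f ∈ swapTuples N k m, hookSeries k (swapProd f)

/-- The sum of `hookSeriesAt k` over monotone tuples of transpositions of the letters up to `k`. -/
noncomputable def hookSumAt (k : Fin N) (m : ℕ) : ℚ⟦X⟧ :=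
  ∑ f ∈ swapTuples N (k + 1) m, hookSeriesAt k (swapProd f)

theorem hookSum_succ (k : Fin N) (m : ℕ) :
    hookSum N (k + 1) (m + 1) =
      (1 - X) * hookSum N k (m + 1) + hookSumAt k m - eulerDer (hookSum N (k + 1) m) := by
  rw [hookSum, sum_swapTuples_succ, hookSum, Finset.mul_sum, hookSumAt, hookSum, map_sum,
    add_sub_assoc, ← Finset.sum_sub_distrib]
  congr 1
  · exact Finset.sum_congr rfl fun f _ => hookSeries_succ k _
  · exact Finset.sum_congr rfl fun f hf =>
      sum_hookSeries_mul_swap k _ fun j hj => swapProd_apply_of_le hf hj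

theorem hookSumAt_succ (k : Fin N) (m : ℕ) :
    hookSumAt k (m + 1) =
      (k : ℕ) * hookSum N k (m + 1) + (k : ℕ) * hookSumAt k m - eulerDer (hookSumAt k m) := by
  rw [hookSumAt, sum_swapTuples_succ, hookSum, Finset.mul_sum, hookSumAt, map_sum,
    add_sub_assoc, Finset.mul_sum, ← Finset.sum_sub_distrib]
  congr 1
  · exact Finset.sum_congr rfl fun f hf =>
      hookSeriesAt_of_fixed k _ (swapProd_apply_of_le hf le_rfl)
  · exact Finset.sum_congr rfl fun f hf =>
      sum_hookSeriesAt_mul_swap k _ fun j hj => swapProd_apply_of_le hf hj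

theorem hookSum_zero (k : ℕ) : hookSum N k 0 = hookSeries k (1 : Perm (Fin N)) := by
  rw [hookSum, swapTuples, sum_monoTuples_zero]
  simp [swapProd]

theorem hookSum_succ_zero (k : Fin N) : hookSum N (k + 1) 0 = (1 - X) * hookSum N k 0 := by
  rw [hookSum_zero, hookSum_zero, hookSeries_succ]

theorem hookSumAt_zero (k : Fin N) : hookSumAt k 0 = (k : ℕ) * hookSum N k 0 := by
  rw [hookSum_zero, hookSumAt, swapTuples, sum_monoTuples_zero, ← hookSeriesAt_of_fixed k 1 rfl]
  simp [swapProd]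

theorem hookSum_one_zero : hookSum N 1 0 = 1 := by
  have h : pencil (1 : Perm (Fin N)) = (1 - X : ℚ⟦X⟧) • 1 := by
    ext1 i j
    simp only [pencil, permSeries, Matrix.sub_apply, Matrix.smul_apply, Matrix.of_apply,
      Matrix.one_apply, Perm.one_apply, smul_eq_mul]
    split_ifs with h <;> simp [h]
  rw [hookSum_zero, hookSeries, h, Matrix.det_smul, Matrix.det_one, mul_one, Fintype.card_fin,
    Nat.add_sub_cancel, ← mul_pow, one_sub_X_mul_geom, one_pow]

theorem hookSum_one_succ (m : ℕ) : hookSum N 1 (m + 1) = 0 := by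
  rw [hookSum, swapTuples, monoTuples_eq_empty, Finset.sum_empty]
  rintro ⟨i, j⟩ h
  have h' : (i : ℕ) < j := h
  exact Nat.one_le_of_lt h'

end HookSums

section FallingProducts

variable {R : Type*} [CommRing R]

/-- The falling product `a (a - t) ⋯ (a - (k - 1) t)`. -/
def fallingProd (a t : R) (k : ℕ) : R := ∏ j ∈ Finset.range k, (a - j * t)

theorem fallingProd_succ (a t : R) (k : ℕ) :
    fallingProd a t (k + 1) = fallingProd a t k * (a - k * t) :=
  Finset.prod_range_succ _ _

theorem fallingProd_succ' (a t : R) (k : ℕ) :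
    fallingProd (a + t) t (k + 1) = (a + t) * fallingProd a t k := by
  rw [fallingProd, Finset.prod_range_succ', mul_comm, fallingProd]
  congr 1
  · simp
  · refine Finset.prod_congr rfl fun j _ => ?_
    push_cast
    ring

theorem fallingProd_add (a b t : R) (n : ℕ) :
    fallingProd (a + b) t n = ∑ ij ∈ Finset.HasAntidiagonal.antidiagonal n,
      (n.choose ij.1 : R) * (fallingProd a t ij.1 * fallingProd b t ij.2) := by
  induction n with
  | zero => simp [fallingProd]
  | succ n ih =>
    rw [Finset.sum_antidiagonal_choose_succ_mul fun i j => fallingProd a t i * fallingProd b t j,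
      ← Finset.sum_add_distrib, fallingProd_succ, ih, Finset.sum_mul]
    refine Finset.sum_congr rfl fun ij hij => ?_
    rw [Finset.HasAntidiagonal.mem_antidiagonal] at hij
    rw [← Nat.choose_symm_of_eq_add hij.symm, fallingProd_succ, fallingProd_succ, ← hij]
    push_cast
    ring

theorem fallingProd_natCast_mul (a : ℕ) (t : R) (k : ℕ) :
    fallingProd (a * t) t k = a.descFactorial k * t ^ k := by
  induction k with
  | zero => simp [fallingProd]
  | succ k ih =>
    rw [fallingProd_succ, ih, Nat.descFactorial_succ, pow_succ]
    rcases le_or_gt k a with h | h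
    · push_cast [h]
      ring
    · simp [Nat.descFactorial_of_lt h]

/-- The product `(1 + x) (1 + 2 x) ⋯ (1 + k x)`. -/
def risingOne (x : R) (k : ℕ) : R := ∏ j ∈ Finset.range k, (1 + (j + 1) * x)

theorem risingOne_succ (x : R) (k : ℕ) :
    risingOne x (k + 1) = risingOne x k * (1 + (k + 1) * x) :=
  Finset.prod_range_succ _ _

theorem risingOne_add (x : R) (r s : ℕ) :
    risingOne x (r + s) = risingOne x r * fallingProd ((r + s : ℕ) * x + 1) x s := by
  induction s with
  | zero => simp [fallingProd]
  | succ s ih =>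
    have h : ((r + (s + 1) : ℕ) : R) * x + 1 = ((r + s : ℕ) * x + 1) + x := by push_cast; ring
    rw [h, fallingProd_succ', ← add_assoc, risingOne_succ, ih]
    push_cast
    ring

theorem risingOne_neg_add (x : R) (r s : ℕ) :
    risingOne (-x) (r + s) =
      risingOne (-x) s * ((-1) ^ r * fallingProd ((r + s : ℕ) * x - 1) x r) := by
  induction r with
  | zero => simp [fallingProd]
  | succ r ih =>
    have h : ((r + 1 + s : ℕ) : R) * x - 1 = ((r + s : ℕ) * x - 1) + x := by push_cast; ring
    rw [h, fallingProd_succ', add_right_comm, risingOne_succ, ih]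
    push_cast
    ring

/-- The product of the linear factors `1 - (c - r) x` with `c ≤ n`, over the contents of a hook. -/
def contentProd (x : R) (n r : ℕ) : R := ∏ c ∈ Finset.range (n + 1), (1 - (c - r) * x)

theorem contentProd_succ (x : R) (n r : ℕ) :
    contentProd x (n + 1) r = contentProd x n r * (1 - (n + 1 - r) * x) := by
  rw [contentProd, Finset.prod_range_succ, contentProd]
  push_cast
  rfl

theorem contentProd_succ_succ (x : R) (n r : ℕ) :
    contentProd x (n + 1) (r + 1) = (1 + (r + 1) * x) * contentProd x n r := by
  rw [contentProd, Finset.prod_range_succ', mul_comm, contentProd]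
  congr 1
  · push_cast
    ring
  · refine Finset.prod_congr rfl fun j _ => ?_
    push_cast
    ring

theorem contentProd_add (x : R) (r s : ℕ) :
    contentProd x (r + s) r = risingOne x r * risingOne (-x) s := by
  induction r with
  | zero =>
    rw [contentProd, Finset.prod_range_succ']
    simp [risingOne, sub_eq_add_neg]
  | succ r ih =>
    rw [add_right_comm, contentProd_succ_succ, ih, risingOne_succ]
    ring

end FallingProducts

section GeneratingSeries

variable {N : ℕ}

/-- The series in the number of transpositions with coefficients those of `X ^ r` in `hookSum`. -/
noncomputable def hookGen (N k r : ℕ) : ℚ⟦X⟧ := mk fun m => coeff r (hookSum N k m)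

/-- The series in the number of transpositions with coefficients those of `X ^ r` in `hookSumAt`. -/
noncomputable def hookGenAt (k : Fin N) (r : ℕ) : ℚ⟦X⟧ := mk fun m => coeff r (hookSumAt k m)

theorem coeff_natCast_mul (a n : ℕ) (f : ℚ⟦X⟧) : coeff n ((a : ℚ⟦X⟧) * f) = a * coeff n f := by
  rw [← nsmul_eq_mul, map_nsmul, nsmul_eq_mul]

theorem hookGenAt_eq (k : Fin N) (r : ℕ) :
    (1 - (((k : ℕ) : ℚ⟦X⟧) - (r : ℚ⟦X⟧)) * X) * hookGenAt k r =
      ((k : ℕ) : ℚ⟦X⟧) * hookGen N k r := by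
  suffices h : hookGenAt k r =
      ((k : ℕ) : ℚ⟦X⟧) * hookGen N k r +
        X * (((k : ℕ) : ℚ⟦X⟧) * hookGenAt k r - (r : ℚ⟦X⟧) * hookGenAt k r) by
    linear_combination h
  ext m
  cases m with
  | zero =>
    simp [hookGenAt, hookGen, hookSumAt_zero, coeff_natCast_mul]
  | succ m =>
    simp only [map_add, map_sub, coeff_succ_X_mul, coeff_natCast_mul, hookGenAt, hookGen, coeff_mk,
      hookSumAt_succ, coeff_eulerDer]
    ring

theorem hookGen_succ_zero (k : Fin N) :
    hookGen N (k + 1) 0 = hookGen N k 0 + X * hookGenAt k 0 := by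
  ext m
  cases m with
  | zero => simp [hookGen, hookSum_succ_zero]
  | succ m =>
    simp only [map_add, coeff_succ_X_mul, hookGenAt, hookGen, coeff_mk, hookSum_succ, map_sub,
      coeff_eulerDer, sub_mul, one_mul, coeff_zero_X_mul]
    simp

theorem hookGen_succ_succ (k : Fin N) (r : ℕ) :
    (1 + ((r : ℚ⟦X⟧) + 1) * X) * hookGen N (k + 1) (r + 1) =
      hookGen N k (r + 1) - hookGen N k r + X * hookGenAt k (r + 1) := by
  suffices h : hookGen N (k + 1) (r + 1) =
      hookGen N k (r + 1) - hookGen N k r +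
        X * (hookGenAt k (r + 1) - ((r + 1 : ℕ) : ℚ⟦X⟧) * hookGen N (k + 1) (r + 1)) by
    push_cast at h
    linear_combination h
  ext m
  cases m with
  | zero => simp [hookGen, hookSum_succ_zero, sub_mul, coeff_succ_X_mul]
  | succ m =>
    simp only [map_add, coeff_succ_X_mul, hookGenAt, hookGen, coeff_mk, hookSum_succ, map_sub,
      coeff_eulerDer, sub_mul, one_mul, coeff_natCast_mul]
    ring

theorem contentProd_mul_hookGen (n r : ℕ) (hn : n < N) :
    contentProd X n r * hookGen N (n + 1) r = (-1) ^ r * (n.choose r : ℚ⟦X⟧) := by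
  induction n generalizing r with
  | zero =>
    have h : hookGen N 1 r = if r = 0 then 1 else 0 := by
      ext m
      cases m with
      | zero =>
        rw [hookGen, coeff_mk, hookSum_one_zero, coeff_one]
        split_ifs <;> simp
      | succ m =>
        rw [hookGen, coeff_mk, hookSum_one_succ]
        split_ifs <;> simp [coeff_one]
    rw [zero_add, h]
    cases r with
    | zero => simp [contentProd]
    | succ r => simp
  | succ n ih =>
    have ih' := fun r => ih r (Nat.lt_of_succ_lt hn)
    have hT := hookGenAt_eq ⟨n + 1, hn⟩
    cases r with
    | zero =>
      have hS := hookGen_succ_zero ⟨n + 1, hn⟩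
      have hT0 := hT 0
      have hc := contentProd_succ (X : ℚ⟦X⟧) n 0
      have i0 := ih' 0
      simp only [Nat.cast_add, Nat.cast_one, Nat.cast_zero, Nat.choose_zero_right, pow_zero]
        at hS hT0 hc i0 ⊢
      rw [hc, hS]
      linear_combination i0 + contentProd X n 0 * X * hT0
    | succ r =>
      have hS := hookGen_succ_succ ⟨n + 1, hn⟩ r
      have hT0 := hT (r + 1)
      have hc := contentProd_succ (X : ℚ⟦X⟧) n (r + 1)
      have hc' := contentProd_succ_succ (X : ℚ⟦X⟧) n r
      have i0 := ih' r
      have i1 := ih' (r + 1)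
      have hne : 1 + ((r : ℚ⟦X⟧) + 1) * X ≠ 0 := by
        intro h
        simpa using congrArg constantCoeff h
      refine mul_left_cancel₀ hne ?_
      rw [Nat.choose_succ_succ']
      simp only [Nat.cast_add, Nat.cast_one] at hS hT0 hc hc' i0 i1 ⊢
      linear_combination contentProd X (n + 1) (r + 1) * hS +
        (hookGen N (n + 1) (r + 1) + X * hookGenAt ⟨n + 1, hn⟩ (r + 1)) * hc +
        contentProd X n (r + 1) * X * hT0 + (1 + ((r : ℚ⟦X⟧) + 1) * X) * (i1 - i0) -
        hookGen N (n + 1) r * hc'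

theorem sum_hookGen (n : ℕ) (hn : n < N) :
    risingOne X n * risingOne (-X) n * ∑ r ∈ Finset.range (n + 1), hookGen N (n + 1) r =
      ((2 * n).descFactorial n : ℚ⟦X⟧) * X ^ n := by
  have hX : ((2 * n : ℕ) : ℚ⟦X⟧) * X =
      ((n : ℚ⟦X⟧) * X - 1) + ((n : ℚ⟦X⟧) * X + 1) := by push_cast; ring
  rw [← fallingProd_natCast_mul, hX, fallingProd_add, Finset.mul_sum,
    ← Finset.Nat.sum_antidiagonal_eq_sum_range_succ
      fun r _ => risingOne X n * risingOne (-X) n * hookGen N (n + 1) r]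
  refine Finset.sum_congr rfl fun rs h => ?_
  obtain ⟨r, s⟩ := rs
  obtain rfl : r + s = n := Finset.HasAntidiagonal.mem_antidiagonal.mp h
  have hS := contentProd_mul_hookGen (r + s) r hn
  rw [contentProd_add] at hS
  have hsq : ((-1 : ℚ⟦X⟧) ^ r) ^ 2 = 1 := by rw [← pow_mul, mul_comm, pow_mul]; simp
  rw [risingOne_add, risingOne_neg_add]
  linear_combination (-1) ^ r * fallingProd (((r + s : ℕ) : ℚ⟦X⟧) * X + 1) X s *
    fallingProd (((r + s : ℕ) : ℚ⟦X⟧) * X - 1) X r * hS +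
    fallingProd (((r + s : ℕ) : ℚ⟦X⟧) * X + 1) X s *
    fallingProd (((r + s : ℕ) : ℚ⟦X⟧) * X - 1) X r * ((r + s).choose r : ℚ⟦X⟧) * hsq

/-- The sum of `(m₁ ⋯ m_g) ^ 2` over weakly increasing tuples of positive integers less than `k`. -/
noncomputable def squareSum (N k g : ℕ) : ℚ :=
  ∑ f ∈ monoTuples (fun a : Fin N => 1 ≤ (a : ℕ)) (fun a => a) k g, (∏ i, ((f i : ℕ) : ℚ)) ^ 2

theorem squareSum_zero (N k : ℕ) : squareSum N k 0 = 1 := by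
  rw [squareSum, sum_monoTuples_zero]
  simp

theorem squareSum_one_succ (N g : ℕ) : squareSum N 1 (g + 1) = 0 := by
  rw [squareSum, monoTuples_eq_empty _ _ _ _ fun _ h => h, Finset.sum_empty]

theorem squareSum_succ_succ (k : Fin N) (g : ℕ) :
    squareSum N (k + 1) (g + 1) =
      squareSum N k (g + 1) + ((k : ℕ) : ℚ) ^ 2 * squareSum N (k + 1) g := by
  rw [squareSum, sum_monoTuples_succ, squareSum, squareSum, Finset.mul_sum]
  refine congrArg _ (Finset.sum_congr rfl fun f _ => ?_)
  simp only [Fin.prod_univ_castSucc, Fin.snoc_castSucc, Fin.snoc_last, Fin.val_inj]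
  rcases Nat.eq_zero_or_pos (k : ℕ) with h | h
  · rw [Finset.sum_eq_zero]
    · simp [h]
    · intro a ha
      obtain ⟨-, h1, rfl⟩ := Finset.mem_filter.mp ha
      omega
  · rw [Finset.sum_eq_single_of_mem k (Finset.mem_filter.mpr ⟨Finset.mem_univ k, h, rfl⟩)]
    · ring
    · intro a ha hne
      exact absurd (Finset.mem_filter.mp ha).2.2 hne

/-- The even series with coefficients `squareSum`. -/
noncomputable def squareGen (N k : ℕ) : ℚ⟦X⟧ :=
  mk fun m => if Even m then squareSum N k (m / 2) else 0

theorem squareGen_one (N : ℕ) : squareGen N 1 = 1 := by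
  ext m
  rw [squareGen, coeff_mk, coeff_one]
  rcases m with _ | _ | m
  · simp [squareSum_zero]
  · simp
  · rw [show (m + 1 + 1) / 2 = m / 2 + 1 by omega, squareSum_one_succ]
    simp

theorem squareGen_succ (k : Fin N) :
    (1 - (((k : ℕ) : ℚ⟦X⟧) * X) ^ 2) * squareGen N (k + 1) = squareGen N k := by
  suffices h : squareGen N (k + 1) =
      squareGen N k + X * (X * (((k ^ 2 : ℕ) : ℚ⟦X⟧) * squareGen N (k + 1))) by
    push_cast at h
    linear_combination h
  ext m
  rcases m with _ | _ | m
  · simp [squareGen, squareSum_zero]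
  · simp [squareGen, coeff_succ_X_mul]
  · simp only [map_add, coeff_succ_X_mul, coeff_natCast_mul, squareGen, coeff_mk, Nat.even_add_one,
      not_not, show (m + 1 + 1) / 2 = m / 2 + 1 by omega, squareSum_succ_succ]
    split_ifs <;> simp

theorem risingOne_mul_squareGen (n : ℕ) (hn : n < N) :
    risingOne X n * risingOne (-X) n * squareGen N (n + 1) = 1 := by
  induction n with
  | zero => simp [risingOne, squareGen_one]
  | succ n ih =>
    have h := squareGen_succ ⟨n + 1, hn⟩
    push_cast at h
    rw [risingOne_succ, risingOne_succ]
    linear_combination ih (Nat.lt_of_succ_lt hn) + risingOne X n * risingOne (-X) n * h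

theorem sum_coeff_hookSum (n g : ℕ) :
    ∑ r ∈ Finset.range (n + 1), coeff r (hookSum (n + 1) (n + 1) (n + 2 * g)) =
      (2 * n).descFactorial n * squareSum (n + 1) (n + 1) g := by
  have h1 := sum_hookGen n n.lt_succ_self
  have h2 := risingOne_mul_squareGen n n.lt_succ_self
  have h : ∑ r ∈ Finset.range (n + 1), hookGen (n + 1) (n + 1) r =
      ((2 * n).descFactorial n : ℚ⟦X⟧) * (X ^ n * squareGen (n + 1) (n + 1)) := by
    linear_combination squareGen (n + 1) (n + 1) * h1 -
      (∑ r ∈ Finset.range (n + 1), hookGen (n + 1) (n + 1) r) * h2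
  have h := congrArg (coeff (n + 2 * g)) h
  rw [map_sum, coeff_natCast_mul, add_comm n (2 * g), coeff_X_pow_mul] at h
  simpa [hookGen, squareGen, add_comm] using h

end GeneratingSeries

theorem sum_coeff_hookSum_eq_mono (n m : ℕ) :
    ∑ r ∈ Finset.range (n + 1), coeff r (hookSum (n + 1) (n + 1) m) =
      ((n + 1 : ℕ) : ℚ) * Mono (n + 1) m := by
  have hM : Mono (n + 1) m = Finset.card {f ∈ swapTuples (n + 1) (n + 1) m |
      ∀ i j, (swapProd f).SameCycle i j} := by
    refine Nat.subtype_card _ fun f => ?_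
    rw [Finset.mem_filter, ← cycleType_eq_finRotate_iff n.succ_pos, swapTuples, mem_monoTuples,
      swapProd]
    simp only [Fin.val_fin_le, Fin.is_lt, implies_true, and_true, and_assoc]
  simp only [hookSum, map_sum]
  rw [Finset.sum_comm, hM, Finset.sum_congr rfl fun f _ => sum_coeff_hookSeries n.succ_pos _,
    ← Finset.sum_filter, Finset.sum_const, nsmul_eq_mul, mul_comm]

/-- Explicit formula for 1-part monotone Hurwitz numbers:
`m_g(d) = ((2d−2)!/(d!(d−1)!)) · Σ_{1 ≤ m₁ ≤ ⋯ ≤ m_g ≤ d−1} (m₁⋯m_g)²`, where the sum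
is over weakly increasing `g`-tuples of integers in `{1, …, d−1}`. -/
theorem monotone_hurwitz_formula (g d : ℕ) (hd : 1 ≤ d) :
    monotoneHurwitz g d =
      ((2 * d - 2).factorial : ℚ) / ((d.factorial : ℚ) * ((d - 1).factorial : ℚ)) *
        ∑ f ∈ Finset.univ.filter
            (fun f : Fin g → Fin d => Monotone f ∧ ∀ i, 1 ≤ ((f i : ℕ))),
          (∏ i, ((f i : ℕ) : ℚ)) ^ 2 := by
  obtain ⟨n, rfl⟩ : ∃ n, d = n + 1 := ⟨d - 1, by omega⟩
  have hsum : ∑ f ∈ Finset.univ.filter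
      (fun f : Fin g → Fin (n + 1) => Monotone f ∧ ∀ i, 1 ≤ ((f i : ℕ))),
        (∏ i, ((f i : ℕ) : ℚ)) ^ 2 = squareSum (n + 1) (n + 1) g := by
    rw [squareSum]
    refine Finset.sum_congr ?_ fun _ _ => rfl
    ext f
    simp only [Finset.mem_filter, Finset.mem_univ, true_and, mem_monoTuples, Fin.val_fin_le,
      Fin.is_lt, implies_true, and_true]
    exact and_comm
  have h := (sum_coeff_hookSum_eq_mono n (n + 2 * g)).symm.trans (sum_coeff_hookSum n g)
  have hfac : ((n.factorial * (2 * n).descFactorial n : ℕ) : ℚ) = (2 * n).factorial := by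
    have := Nat.factorial_mul_descFactorial (show n ≤ 2 * n by omega)
    rw [show 2 * n - n = n by omega] at this
    rw [this]
  have hn : (n.factorial : ℚ) ≠ 0 := Nat.cast_ne_zero.mpr n.factorial_ne_zero
  rw [hsum, monotoneHurwitz, show n + 1 + 2 * g - 1 = n + 2 * g by omega,
    show 2 * (n + 1) - 2 = 2 * n by omega, Nat.add_sub_cancel, ← hfac, Nat.factorial_succ]
  push_cast at h ⊢
  have hn1 : (n : ℚ) + 1 ≠ 0 := by positivity
  field_simp
  linear_combination h
end

section
/- (Polynomial structure of 1-part monotone Hurwitz numbers) For integers d ≥ 1 and m ≥ 0, let M(d, m) be the number of monotone m-tuples (τ₁, …, τ_m) of transpositions in S_d (writing τ_i = (a_i b_i) with a_i < b_i, one has b₁ ≤ ⋯ ≤ b_m) whose product is a d-cycle, and for g ≥ 0 define m_g(d) = M(d, d+2g−1)/(d−1)!. Then for every integer g ≥ 1 there exists a polynomial p_g ∈ ℚ[x] of degree 3g−1 such that m_g(d) = binom(2d, d)·p_g(d) for all integers d ≥ 1. -/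
open PowerSeries in
/-- The power series `2 sinh (x / 2)`. -/
noncomputable def twoSinhHalf : PowerSeries ℚ :=
  rescale (1 / 2) (exp ℚ) - rescale (-1 / 2) (exp ℚ)

/-- The complete homogeneous symmetric polynomial of degree `g` evaluated at
`1², 2², …, n²`. -/
def hsymmSquares : ℕ → ℕ → ℚ
  | 0, _ => 1
  | _ + 1, 0 => 0
  | g + 1, n + 1 => hsymmSquares (g + 1) n + (n + 1) ^ 2 * hsymmSquares g (n + 1)

namespace twoSinhHalf

open PowerSeries

lemma derivative_rescale_exp (a : ℚ) :
    derivative ℚ (rescale a (exp ℚ)) = C a * rescale a (exp ℚ) := by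
  ext n
  simp only [coeff_derivative, coeff_rescale, coeff_exp, coeff_C_mul, Nat.factorial_succ]
  have : (n.factorial : ℚ) ≠ 0 := by positivity
  have : (n : ℚ) + 1 ≠ 0 := by positivity
  simp
  field_simp
  ring

lemma rescale_exp_mul : rescale (1 / 2 : ℚ) (exp ℚ) * rescale (-1 / 2) (exp ℚ) = 1 := by
  rw [exp_mul_exp_eq_exp_add]
  ext n
  rcases n with _ | n <;> norm_num [coeff_rescale, coeff_one, coeff_exp]

lemma derivative_derivative_pow (N : ℕ) :
    derivative ℚ (derivative ℚ (twoSinhHalf ^ (N + 2))) =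
      C (((N : ℚ) + 2) ^ 2 / 4) * twoSinhHalf ^ (N + 2)
        + C (((N : ℚ) + 2) * (N + 1)) * twoSinhHalf ^ N := by
  set E := rescale (1 / 2 : ℚ) (exp ℚ) with hE
  set F := rescale (-1 / 2 : ℚ) (exp ℚ) with hF
  have hEF : E * F = 1 := rescale_exp_mul
  have hdE : derivative ℚ E = C (1 / 2) * E := derivative_rescale_exp _
  have hdF : derivative ℚ F = C (-1 / 2) * F := derivative_rescale_exp _
  have hS : twoSinhHalf = E - F := rfl
  have hC2 : (C (1 / 2 : ℚ) : ℚ⟦X⟧) * 2 = 1 := by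
    rw [← map_ofNat C 2, ← map_mul]; norm_num
  have hCneg : (C (-1 / 2 : ℚ) : ℚ⟦X⟧) = - C (1 / 2) := by rw [← map_neg]; norm_num
  rw [hCneg] at hdF
  have e1 : (C (((N : ℚ) + 2) ^ 2 / 4) : ℚ⟦X⟧) = C (1 / 2) ^ 2 * ((N : ℚ⟦X⟧) + 2) ^ 2 := by
    rw [show (N : ℚ⟦X⟧) + 2 = C ((N : ℚ) + 2) by simp [map_ofNat], ← map_pow, ← map_pow, ← map_mul]
    congr 1; ring
  have e2 : (C (((N : ℚ) + 2) * (N + 1)) : ℚ⟦X⟧) = ((N : ℚ⟦X⟧) + 2) * (N + 1) := by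
    simp [map_ofNat]
  rw [e1, e2, hS]
  have dc : derivative ℚ (C (1 / 2 : ℚ)) = 0 := by simp
  generalize (C (1 / 2 : ℚ) : ℚ⟦X⟧) = c at *
  have hc : (E + F) ^ 2 = (E - F) ^ 2 + 4 := by linear_combination 4 * hEF
  have d1 : derivative ℚ (E - F) = c * (E + F) := by rw [map_sub, hdE, hdF]; ring
  have d2 : derivative ℚ (E + F) = c * (E - F) := by rw [map_add, hdE, hdF]; ring
  simp only [Derivation.leibniz_pow, Derivation.leibniz, smul_eq_mul, nsmul_eq_mul, d1, d2, dc,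
    Derivation.map_natCast, Nat.add_sub_cancel,
    show N + 2 - 1 = N + 1 from rfl, mul_zero, add_zero]
  push_cast
  linear_combination (N + 2) * (N + 1) * (E - F) ^ N * c ^ 2 * hc +
    (N + 2) * (N + 1) * (E - F) ^ N * (2 * c + 1) * hC2

lemma coeff_pow_recurrence (N k : ℕ) :
    ((k : ℚ) + 2) * (k + 1) * coeff (k + 2) (twoSinhHalf ^ (N + 2)) =
      ((N : ℚ) + 2) ^ 2 / 4 * coeff k (twoSinhHalf ^ (N + 2))
        + ((N : ℚ) + 2) * (N + 1) * coeff k (twoSinhHalf ^ N) := by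
  have h := congrArg (coeff k) (derivative_derivative_pow N)
  simp only [map_add, coeff_C_mul, coeff_derivative] at h
  rw [← h]
  push_cast
  ring

lemma exists_eq_X_mul : ∃ V : ℚ⟦X⟧, constantCoeff V = 1 / 24 ∧
    twoSinhHalf = X * (1 + X ^ 2 * V) := by
  have hdvd : (X : ℚ⟦X⟧) ^ 3 ∣ twoSinhHalf - X := by
    rw [X_pow_dvd_iff]
    intro m hm
    have h0 : ∀ a : ℚ, constantCoeff (rescale a (exp ℚ)) = 1 := fun a => by
      rw [← coeff_zero_eq_constantCoeff_apply, coeff_rescale]; simp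
    interval_cases m <;>
      simp [h0, twoSinhHalf, coeff_rescale, coeff_exp, coeff_X] <;> norm_num [Nat.factorial]
  obtain ⟨V, hV⟩ := hdvd
  refine ⟨V, ?_, ?_⟩
  · have h := congrArg (coeff 3) hV
    rw [show (3 : ℕ) = 0 + 3 from rfl, coeff_X_pow_mul] at h
    rw [← coeff_zero_eq_constantCoeff_apply, ← h]
    simp [twoSinhHalf, coeff_rescale, coeff_exp, coeff_X]
    norm_num [Nat.factorial]
  · linear_combination hV

lemma coeff_self_pow (N : ℕ) : coeff N (twoSinhHalf ^ N) = 1 := by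
  obtain ⟨V, -, hV⟩ := exists_eq_X_mul
  rw [hV, mul_pow]
  have := coeff_X_pow_mul ((1 + X ^ 2 * V) ^ N) N 0
  rw [zero_add] at this
  rw [this]
  simp

lemma exists_polynomial_coeff (g : ℕ) : ∃ s : Polynomial ℚ, s.natDegree = g ∧
    ∀ N : ℕ, coeff (N + 2 * g) (twoSinhHalf ^ N) = s.eval (N : ℚ) := by
  obtain ⟨V, hV0, hV⟩ := exists_eq_X_mul
  let s : Polynomial ℚ := ∑ k ∈ Finset.range (g + 1),
    Polynomial.C (coeff (2 * (g - k)) (V ^ k) / k.factorial) * descPochhammer ℚ k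
  refine ⟨s, ?_, ?_⟩
  · have hlow : (∑ k ∈ Finset.range g,
        Polynomial.C (coeff (2 * (g - k)) (V ^ k) / k.factorial) * descPochhammer ℚ k).degree
          < (g : ℕ) := by
      refine (Polynomial.degree_sum_le _ _).trans_lt ?_
      rw [Finset.sup_lt_iff (by exact_mod_cast WithBot.bot_lt_coe g)]
      intro k hk
      refine (Polynomial.degree_le_natDegree).trans_lt ?_
      refine (WithBot.coe_le_coe.mpr (Polynomial.natDegree_C_mul_le _ _)).trans_lt ?_
      rw [descPochhammer_natDegree]
      exact WithBot.coe_lt_coe.mpr (Finset.mem_range.mp hk)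
    have htop : (Polynomial.C (coeff (2 * (g - g)) (V ^ g) / g.factorial)
        * descPochhammer ℚ g).degree = (g : ℕ) := by
      have hc : (coeff (2 * (g - g)) (V ^ g) / (g.factorial : ℚ)) ≠ 0 := by
        simp [hV0, Nat.factorial_ne_zero]
      rw [Polynomial.degree_C_mul hc,
        Polynomial.degree_eq_natDegree (monic_descPochhammer ℚ g).ne_zero,
        descPochhammer_natDegree]
    apply Polynomial.natDegree_eq_of_degree_eq_some
    simp only [s]
    rw [Finset.sum_range_succ, Polynomial.degree_add_eq_right_of_degree_lt (by rw [htop]; exact hlow),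
      htop]
  · intro N
    rw [hV, mul_pow, add_comm N, coeff_X_pow_mul, add_comm 1, add_pow, map_sum]
    have hterm : ∀ k, coeff (2 * g) ((X ^ 2 * V) ^ k * 1 ^ (N - k) * (N.choose k : ℚ⟦X⟧)) =
        if k ≤ g then coeff (2 * (g - k)) (V ^ k) * N.choose k else 0 := by
      intro k
      rw [one_pow, mul_one, mul_pow, ← pow_mul, mul_assoc, coeff_X_pow_mul']
      by_cases h : k ≤ g
      · rw [if_pos h, if_pos (by omega), ← Nat.mul_sub,
          show (N.choose k : ℚ⟦X⟧) = C (N.choose k : ℚ) by simp, coeff_mul_C]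
      · rw [if_neg h, if_neg (by omega)]
    simp_rw [hterm]
    have heval : s.eval (N : ℚ) = ∑ k ∈ Finset.range (g + 1),
        coeff (2 * (g - k)) (V ^ k) * N.choose k := by
      simp only [s, Polynomial.eval_finsetSum, Polynomial.eval_mul, Polynomial.eval_C]
      refine Finset.sum_congr rfl fun k _ => ?_
      rw [descPochhammer_eval_eq_descFactorial, Nat.descFactorial_eq_factorial_mul_choose]
      push_cast
      have : (k.factorial : ℚ) ≠ 0 := by positivity
      field_simp
    rw [heval, ← Finset.sum_filter]
    have h1 : ∀ k, N < k → (coeff (2 * (g - k)) (V ^ k) * (N.choose k : ℚ)) = 0 := by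
      intro k hk; simp [Nat.choose_eq_zero_of_lt hk]
    apply Finset.sum_subset_zero_on_sdiff
    · intro k; simp only [Finset.mem_filter, Finset.mem_range]; omega
    · intro k hk
      simp only [Finset.mem_sdiff, Finset.mem_filter, Finset.mem_range] at hk
      exact h1 k (by omega)
    · intros; rfl

end twoSinhHalf

lemma hsymmSquares_mul_factorial (g n : ℕ) :
    hsymmSquares g n * (2 * n).factorial =
      (2 * n + 2 * g).factorial * PowerSeries.coeff (2 * n + 2 * g) (twoSinhHalf ^ (2 * n)) := by
  induction g, n using hsymmSquares.induct with
  | case1 n => simp [hsymmSquares, twoSinhHalf.coeff_self_pow]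
  | case2 g => simp [hsymmSquares, PowerSeries.coeff_one]
  | case3 g n ih1 ih2 =>
    have h := twoSinhHalf.coeff_pow_recurrence (2 * n) (2 * n + 2 * (g + 1))
    rw [show 2 * (n + 1) + 2 * g = 2 * n + 2 * (g + 1) by ring,
      show 2 * (n + 1) = 2 * n + 2 by ring] at ih2
    rw [hsymmSquares, show 2 * (n + 1) + 2 * (g + 1) = 2 * n + 2 * (g + 1) + 2 by ring,
      show 2 * (n + 1) = 2 * n + 2 by ring]
    simp only [Nat.factorial_succ] at *
    push_cast at *
    linear_combination (2 * (n : ℚ) + 1 + 1) * (2 * n + 1) * ih1 + (n + 1 : ℚ) ^ 2 * ih2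
      - ((2 * n + 2 * g + 1 + 1).factorial : ℚ) * h

lemma exists_polynomial_hsymmSquares (g : ℕ) (hg : 1 ≤ g) : ∃ p : Polynomial ℚ,
    p.natDegree = 3 * g - 1 ∧
      ∀ n : ℕ, hsymmSquares g n = 2 * (2 * n + 1) * p.eval ((n + 1 : ℕ) : ℚ) := by
  obtain ⟨s, hs, hs'⟩ := twoSinhHalf.exists_polynomial_coeff g
  let q : Polynomial ℚ := Polynomial.C (1 / 2) *
    ((ascPochhammer ℚ (2 * g - 1)).comp (Polynomial.X + Polynomial.C 2) * s)
  let r : Polynomial ℚ := Polynomial.C 2 * Polynomial.X - Polynomial.C 2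
  have hr : r.natDegree = 1 := by
    simp only [r]; compute_degree!
  refine ⟨q.comp r, ?_, ?_⟩
  · have hq1 : (ascPochhammer ℚ (2 * g - 1)).comp (Polynomial.X + Polynomial.C 2) ≠ 0 := by
      apply Polynomial.Monic.ne_zero
      exact (monic_ascPochhammer ℚ _).comp_X_add_C 2
    have hs0 : s ≠ 0 := by
      rintro rfl
      simp at hs; omega
    rw [Polynomial.natDegree_comp, hr, mul_one]
    simp only [q]
    rw [Polynomial.natDegree_C_mul (by norm_num), Polynomial.natDegree_mul hq1 hs0,
      Polynomial.natDegree_comp, ascPochhammer_natDegree, Polynomial.natDegree_X_add_C, hs]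
    omega
  · intro n
    have h := hsymmSquares_mul_factorial g n
    rw [hs'] at h
    have hf : ((2 * n).factorial : ℚ) * (2 * n + 1) * (ascPochhammer ℚ (2 * g - 1)).eval
        (2 * (n : ℚ) + 2) = (2 * n + 2 * g).factorial := by
      have h1 := Nat.factorial_mul_ascFactorial (2 * n + 1) (2 * g - 1)
      rw [show 2 * n + 1 + (2 * g - 1) = 2 * n + 2 * g by omega] at h1
      rw [← h1, show 2 * (n : ℚ) + 2 = ((2 * n + 1 + 1 : ℕ) : ℚ) by push_cast; ring,
        ← ascPochhammer_eval_cast, ascPochhammer_nat_eq_ascFactorial, Nat.factorial_succ]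
      push_cast
      ring
    rw [← hf] at h
    have hne : ((2 * n).factorial : ℚ) ≠ 0 := by positivity
    have he : r.eval ((n + 1 : ℕ) : ℚ) = 2 * n := by simp [r]; ring
    rw [Polynomial.eval_comp, he]
    simp only [q, Polynomial.eval_mul, Polynomial.eval_comp, Polynomial.eval_C,
      Polynomial.eval_add, Polynomial.eval_X]
    apply mul_right_cancel₀ hne
    rw [h]
    push_cast
    ring

/-- The complete homogeneous symmetric polynomial of degree `m` in the values `c i`, written
as a sum over weakly increasing words. -/
noncomputable def monotoneSum {d : ℕ} (c : Fin d → ℚ) (m : ℕ) : ℚ :=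
  open Classical in ∑ b : Fin m → Fin d with Monotone b, ∏ i, c (b i)

lemma monotoneSum_zero {d : ℕ} (c : Fin d → ℚ) : monotoneSum c 0 = 1 := by
  classical
  rw [monotoneSum, Finset.filter_true_of_mem fun b _ => Subsingleton.monotone b]
  simp

lemma monotoneSum_succ {d : ℕ} (c : Fin (d + 1) → ℚ) (m : ℕ) :
    monotoneSum c (m + 1) =
      monotoneSum (fun i : Fin d => c i.succ) (m + 1) + c 0 * monotoneSum c m := by
  classical
  unfold monotoneSum
  rw [← Finset.sum_filter_add_sum_filter_not _ (fun b => b 0 = 0), add_comm]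
  congr 1
  · symm
    refine Finset.sum_nbij (fun b i => (b i).succ) ?_ ?_ ?_ ?_
    · intro b hb
      simp only [Finset.mem_filter, Finset.mem_univ, true_and] at hb ⊢
      exact ⟨fun i j hij => Fin.succ_le_succ_iff.mpr (hb hij), Fin.succ_ne_zero _⟩
    · intro b _ b' _ h
      funext i
      exact Fin.succ_injective _ (congrFun h i)
    · intro b hb
      simp only [Finset.coe_filter, Finset.mem_filter, Finset.mem_univ, true_and,
        Set.mem_ofPred_eq, Set.mem_image] at hb ⊢
      have hne : ∀ i, b i ≠ 0 := fun i h0 =>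
        hb.2 (Fin.le_zero_iff.mp (h0 ▸ hb.1 (Fin.zero_le i)))
      refine ⟨fun i => (b i).pred (hne i), fun i j hij => ?_, ?_⟩
      · exact Fin.pred_le_pred_iff.mpr (hb.1 hij)
      · funext i; simp
    · intros; rfl
  · rw [Finset.mul_sum]
    symm
    refine Finset.sum_nbij (fun b => Fin.cons 0 b) ?_ ?_ ?_ ?_
    · intro b hb
      simp only [Finset.mem_filter, Finset.mem_univ, true_and] at hb ⊢
      refine ⟨?_, rfl⟩
      intro i j hij
      induction i using Fin.cases with
      | zero => exact Fin.zero_le _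
      | succ i =>
        induction j using Fin.cases with
        | zero => exact absurd hij (by simp)
        | succ j => simpa using hb (Fin.succ_le_succ_iff.mp hij)
    · intro b _ b' _ h
      exact (Fin.cons_injective2 h).2
    · intro b hb
      simp only [Finset.coe_filter, Finset.mem_filter, Finset.mem_univ, true_and,
        Set.mem_ofPred_eq, Set.mem_image] at hb ⊢
      refine ⟨Fin.tail b, fun i j hij => hb.1 (Fin.succ_le_succ_iff.mpr hij), ?_⟩
      rw [← hb.2, Fin.cons_self_tail]
    · intro b _
      simp [Fin.prod_univ_succ]

open PowerSeries in
lemma mk_monotoneSum_mul_prod {d : ℕ} (c : Fin d → ℚ) :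
    PowerSeries.mk (monotoneSum c) * ∏ i, (1 - C (c i) * X) = 1 := by
  induction d with
  | zero =>
    ext m
    rcases m with _ | m
    · simp [monotoneSum_zero]
    · simp [monotoneSum, coeff_one]
  | succ d ih =>
    rw [Fin.prod_univ_succ, ← mul_assoc]
    conv_rhs => rw [← ih fun i => c i.succ]
    congr 1
    ext m
    rw [mul_sub, mul_one, map_sub, mul_comm _ X, ← mul_assoc, mul_comm _ (C _ : ℚ⟦X⟧),
      coeff_C_mul]
    rcases m with _ | m
    · simp [monotoneSum_zero]
    · rw [coeff_succ_mul_X]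
      simp [monotoneSum_succ c m]

section Products

open Finset

variable {R : Type*} [CommRing R]

lemma sum_choose_mul_prod_sub (x y t : R) (n : ℕ) :
    ∑ p ∈ antidiagonal n, (n.choose p.1 : R) *
      ((∏ i ∈ range p.1, (y - i * t)) * ∏ i ∈ range p.2, (x - i * t)) =
      ∏ i ∈ range n, (x + y - i * t) := by
  induction n with
  | zero => simp
  | succ n ih =>
    rw [Finset.sum_antidiagonal_choose_succ_mul
      (fun a b => (∏ i ∈ range a, (y - i * t)) * ∏ i ∈ range b, (x - i * t)),
      ← Finset.sum_add_distrib, prod_range_succ, ← ih, sum_mul]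
    refine sum_congr rfl fun p hp => ?_
    have hn : (n : R) = p.1 + p.2 := by
      rw [← Nat.cast_add, mem_antidiagonal.mp hp]
    rw [prod_range_succ _ p.1, prod_range_succ _ p.2, hn,
      Nat.choose_symm_of_eq_add (mem_antidiagonal.mp hp).symm]
    ring

lemma prod_one_sub_mul_eq (t : R) (r k : ℕ) :
    (∏ j ∈ range (r + k + 1), (1 - ((j : R) - r) * t)) *
      (((-1) ^ r * ∏ i ∈ range r, ((((r + k : ℕ) : R) * t - 1) - i * t)) *
        ∏ i ∈ range k, ((((r + k : ℕ) : R) * t + 1) - i * t)) =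
      ∏ i ∈ range (r + k), (1 - ((i : R) + 1) ^ 2 * t ^ 2) := by
  have hsplit : ∏ j ∈ range (r + k + 1), (1 - ((j : R) - r) * t) =
      (∏ j ∈ range r, (1 + ((j : R) + 1) * t)) * ∏ j ∈ range k, (1 - ((j : R) + 1) * t) := by
    rw [add_assoc, prod_range_add, prod_range_succ']
    congr 1
    · rw [← prod_range_reflect]
      refine prod_congr rfl fun j hj => ?_
      have hj' := mem_range.mp hj
      rw [Nat.sub_sub, Nat.cast_sub (by omega)]
      push_cast; ring
    · push_cast
      simp
  have hx : ∏ i ∈ range k, ((((r + k : ℕ) : R) * t + 1) - i * t) =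
      ∏ i ∈ range k, (1 + (((r + i : ℕ) : R) + 1) * t) := by
    rw [← prod_range_reflect]
    refine prod_congr rfl fun j hj => ?_
    have hj' := mem_range.mp hj
    rw [Nat.sub_sub, Nat.cast_sub (by omega)]
    push_cast; ring
  have hy : (-1) ^ r * ∏ i ∈ range r, ((((r + k : ℕ) : R) * t - 1) - i * t) =
      ∏ i ∈ range r, (1 - (((k + i : ℕ) : R) + 1) * t) := by
    have : ((-1 : R)) ^ r = ∏ _i ∈ range r, (-1 : R) := by simp
    rw [this, ← prod_mul_distrib, ← prod_range_reflect]
    refine prod_congr rfl fun j hj => ?_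
    have hj' := mem_range.mp hj
    rw [Nat.sub_sub, Nat.cast_sub (by omega)]
    push_cast; ring
  rw [hsplit, hx, hy]
  calc _ = ((∏ j ∈ range r, (1 + ((j : R) + 1) * t)) *
          ∏ i ∈ range k, (1 + (((r + i : ℕ) : R) + 1) * t)) *
        ((∏ j ∈ range k, (1 - ((j : R) + 1) * t)) *
          ∏ i ∈ range r, (1 - (((k + i : ℕ) : R) + 1) * t)) := by ring
    _ = (∏ j ∈ range (r + k), (1 + ((j : R) + 1) * t)) *
        ∏ j ∈ range (r + k), (1 - ((j : R) + 1) * t) := by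
      rw [← prod_range_add (fun j => (1 + ((j : R) + 1) * t)),
        ← prod_range_add (fun j => (1 - ((j : R) + 1) * t)), add_comm k r]
    _ = _ := by
      rw [← prod_mul_distrib]
      exact prod_congr rfl fun j _ => by ring

end Products

section Series

open PowerSeries Finset

lemma exists_inverse_prod_one_sub_sq (n : ℕ) : ∃ Z : ℚ⟦X⟧,
    Z * ∏ i ∈ range n, (1 - ((i : ℚ⟦X⟧) + 1) ^ 2 * X ^ 2) = 1 ∧
      ∀ g, coeff (2 * g) Z = hsymmSquares g n := by
  let Z : ℕ → ℚ⟦X⟧ := fun n =>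
    PowerSeries.mk fun m => if Even m then hsymmSquares (m / 2) n else 0
  refine ⟨Z n, ?_, fun g => by simp [Z]⟩
  induction n with
  | zero =>
    ext m
    by_cases hm : Even m
    · obtain ⟨k, rfl⟩ := hm
      rcases k with _ | k
      · simp [Z, hsymmSquares]
      · simp [Z, ← two_mul, hsymmSquares, coeff_one]
    · have : m ≠ 0 := by rintro rfl; simp at hm
      simp [Z, hm, coeff_one, this]
  | succ n ih =>
    rw [prod_range_succ, mul_comm (∏ i ∈ range n, _), ← mul_assoc]
    conv_rhs => rw [← ih]
    congr 1
    ext m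
    rw [show ((n : ℚ⟦X⟧) + 1) ^ 2 = C (((n : ℚ) + 1) ^ 2) by simp, mul_sub, mul_one, map_sub,
      mul_left_comm, coeff_C_mul, coeff_mul_X_pow']
    by_cases h2 : 2 ≤ m
    · obtain ⟨k, rfl⟩ := Nat.exists_eq_add_of_le' h2
      by_cases hk : Even k
      · obtain ⟨l, rfl⟩ := hk
        simp [Z, ← two_mul, hsymmSquares, Nat.even_add,
          show (2 * l + 2) / 2 = l + 1 by omega]
      · simp [Z, hk, Nat.even_add]
    · interval_cases m <;> simp [Z, hsymmSquares]

lemma coeff_sum_choose_mul (n g : ℕ) (E : ℕ → ℚ⟦X⟧)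
    (hE : ∀ r ≤ n, E r * ∏ j ∈ range (n + 1), (1 - ((j : ℚ⟦X⟧) - (r : ℚ⟦X⟧)) * (X : ℚ⟦X⟧)) = 1) :
    (n.factorial : ℚ) * coeff (n + 2 * g)
      (∑ r ∈ range (n + 1), (-1) ^ r * (n.choose r : ℚ⟦X⟧) * E r) =
        (2 * n).factorial * hsymmSquares g n := by
  obtain ⟨Z, hZ, hZg⟩ := exists_inverse_prod_one_sub_sq n
  have hterm : ∀ p ∈ antidiagonal n, (-1) ^ p.1 * (n.choose p.1 : ℚ⟦X⟧) * E p.1 =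
      Z * ((n.choose p.1 : ℚ⟦X⟧) *
        ((∏ i ∈ range p.1, (((n : ℚ⟦X⟧) * (X : ℚ⟦X⟧) - 1) - (i : ℚ⟦X⟧) * (X : ℚ⟦X⟧))) *
        ∏ i ∈ range p.2, (((n : ℚ⟦X⟧) * (X : ℚ⟦X⟧) + 1) - (i : ℚ⟦X⟧) * (X : ℚ⟦X⟧)))) := by
    rintro ⟨r, k⟩ hp
    obtain rfl : r + k = n := mem_antidiagonal.mp hp
    have h := prod_one_sub_mul_eq (X : ℚ⟦X⟧) r k
    have hr := hE r (by omega)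
    rw [← h] at hZ
    have hsq : ((-1 : ℚ⟦X⟧) ^ r) ^ 2 = 1 := by rw [← pow_mul, mul_comm, pow_mul]; simp
    dsimp only at *
    generalize (∏ j ∈ range (r + k + 1), (1 - ((j : ℚ⟦X⟧) - (r : ℚ⟦X⟧)) * (X : ℚ⟦X⟧))) = P at *
    generalize (∏ i ∈ range r, ((((r + k : ℕ) : ℚ⟦X⟧) * (X : ℚ⟦X⟧) - 1) -
      (i : ℚ⟦X⟧) * (X : ℚ⟦X⟧))) = A at *
    generalize (∏ i ∈ range k, ((((r + k : ℕ) : ℚ⟦X⟧) * (X : ℚ⟦X⟧) + 1) -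
      (i : ℚ⟦X⟧) * (X : ℚ⟦X⟧))) = B at *
    linear_combination (-(-1) ^ r * ((r + k).choose r : ℚ⟦X⟧) * E r) * hZ +
      (Z * ((r + k).choose r : ℚ⟦X⟧) * A * B) * hr +
      (Z * ((r + k).choose r : ℚ⟦X⟧) * A * B * E r * P) * hsq
  rw [← Finset.Nat.sum_antidiagonal_eq_sum_range_succ_mk
    (f := fun p => (-1) ^ p.1 * (n.choose p.1 : ℚ⟦X⟧) * E p.1), sum_congr rfl hterm, ← mul_sum,
    sum_choose_mul_prod_sub]
  have hprod : ∏ i ∈ range n,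
      ((n : ℚ⟦X⟧) * (X : ℚ⟦X⟧) + 1 + ((n : ℚ⟦X⟧) * (X : ℚ⟦X⟧) - 1) - (i : ℚ⟦X⟧) * (X : ℚ⟦X⟧)) =
      C (((2 * n).descFactorial n : ℕ) : ℚ) * X ^ n := by
    rw [Nat.descFactorial_eq_prod_range, Nat.cast_prod, map_prod,
      show (X : ℚ⟦X⟧) ^ n = ∏ _i ∈ range n, X by simp, ← prod_mul_distrib]
    refine prod_congr rfl fun i hi => ?_
    have := mem_range.mp hi
    rw [Nat.cast_sub (by omega)]
    simp [map_ofNat]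
    ring
  rw [hprod, mul_left_comm, coeff_C_mul, add_comm n, coeff_mul_X_pow, hZg]
  have h := Nat.factorial_mul_descFactorial (show n ≤ 2 * n by omega)
  rw [show 2 * n - n = n by omega] at h
  rw [← h]
  push_cast
  ring

end Series

section InvariantSets

open Finset Equiv Equiv.Perm

variable {α : Type*} [Fintype α] [DecidableEq α]

/-- The sign of the restriction of `σ` to `S` when `S` is invariant under `σ`, multiplied by
`(-1) ^ |S|`, and zero when `S` is not invariant. -/
def signedWeight (σ : Perm α) (S : Finset α) : ℚ :=
  if h : ∀ x, σ x ∈ S ↔ x ∈ S then (-1) ^ S.card * (sign (σ.subtypePerm h) : ℤ) else 0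

lemma signedWeight_union {σ : Perm α} {S C : Finset α} (hSC : Disjoint S C)
    (hC : ∀ x, σ x ∈ C ↔ x ∈ C) :
    signedWeight σ (S ∪ C) = signedWeight σ S * signedWeight σ C := by
  have hd := Finset.disjoint_left.mp hSC
  by_cases hS : ∀ x, σ x ∈ S ↔ x ∈ S
  · have hU : ∀ x, σ x ∈ S ∪ C ↔ x ∈ S ∪ C := fun x => by
      simp only [mem_union, hS x, hC x]
    rw [signedWeight, signedWeight, signedWeight, dif_pos hS, dif_pos hC, dif_pos hU]
    have hmul : ofSubtype (σ.subtypePerm hU) =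
        ofSubtype (σ.subtypePerm hS) * ofSubtype (σ.subtypePerm hC) := by
      ext x
      rw [Perm.mul_apply]
      by_cases hxC : x ∈ C
      · rw [ofSubtype_apply_of_mem _ (mem_union_right S hxC), ofSubtype_apply_of_mem _ hxC]
        rw [ofSubtype_apply_of_not_mem]
        · rfl
        · exact fun h => hd h ((hC x).mpr hxC)
      · rw [ofSubtype_apply_of_not_mem (σ.subtypePerm hC) hxC]
        by_cases hxS : x ∈ S
        · rw [ofSubtype_apply_of_mem _ (mem_union_left C hxS), ofSubtype_apply_of_mem _ hxS]
          rfl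
        · rw [ofSubtype_apply_of_not_mem _ hxS, ofSubtype_apply_of_not_mem]
          simp [hxS, hxC]
    have hsign := congrArg sign hmul
    rw [map_mul, sign_ofSubtype, sign_ofSubtype, sign_ofSubtype] at hsign
    rw [hsign, card_union_of_disjoint hSC, pow_add]
    push_cast
    ring
  · rw [signedWeight, signedWeight, dif_neg hS, dif_neg, zero_mul]
    intro hU
    refine hS fun x => ?_
    have := hU x
    simp only [mem_union, hC x] at this
    constructor
    · intro h
      exact (this.mp (Or.inl h)).resolve_right fun hx => hd h ((hC x).mpr hx)
    · intro h
      exact (this.mpr (Or.inl h)).resolve_right fun hx => hd h hx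

lemma signedWeight_orbit (σ : Perm α) (y : α) (C : Finset α)
    (hC : ∀ x, x ∈ C ↔ σ.SameCycle y x) : signedWeight σ C = -1 := by
  classical
  have hinv : ∀ x, σ x ∈ C ↔ x ∈ C := fun x => by
    rw [hC, hC, sameCycle_apply_right]
  rw [signedWeight, dif_pos hinv, ← sign_ofSubtype]
  have hcyc : ofSubtype (σ.subtypePerm hinv) = σ.cycleOf y := by
    ext x
    rw [cycleOf_apply]
    by_cases hx : x ∈ C
    · rw [ofSubtype_apply_of_mem _ hx, if_pos ((hC x).mp hx)]; rfl
    · rw [ofSubtype_apply_of_not_mem _ hx, if_neg fun h => hx ((hC x).mpr h)]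
  rw [hcyc]
  by_cases hy : σ y = y
  · have hCy : C = {y} := by
      ext x
      rw [hC, mem_singleton]
      refine ⟨fun h => ?_, fun h => h ▸ SameCycle.refl _ _⟩
      exact (h.eq_of_left hy).symm
    rw [(cycleOf_eq_one_iff σ).mpr hy, hCy]
    simp
  · have hsupp : (σ.cycleOf y).support = C := by
      ext x
      rw [mem_support_cycleOf_iff, hC]
      exact ⟨fun h => h.1, fun h => ⟨h, mem_support.mpr hy⟩⟩
    rw [(isCycle_cycleOf σ hy).sign, hsupp]
    push_cast
    rw [mul_neg, ← mul_pow]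
    simp

lemma sum_signedWeight_eq_zero {σ : Perm α} {x y : α} (hxy : ¬ σ.SameCycle y x) :
    ∑ S : Finset α with x ∈ S, signedWeight σ S = 0 := by
  classical
  let C : Finset α := {z | σ.SameCycle y z}
  have hC : ∀ z, z ∈ C ↔ σ.SameCycle y z := fun z => by simp [C]
  have hinv : ∀ z, σ z ∈ C ↔ z ∈ C := fun z => by
    rw [hC, hC, sameCycle_apply_right]
  have hyC : y ∈ C := (hC y).mpr (SameCycle.refl _ _)
  have hxC : x ∉ C := fun h => hxy ((hC x).mp h)
  have hdisj : ∀ S : Finset α, Disjoint S C →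
      signedWeight σ S + signedWeight σ (S ∪ C) = 0 := fun S hS => by
    rw [signedWeight_union hS hinv, signedWeight_orbit σ y C hC]; ring
  refine sum_involution (fun S _ => symmDiff S C) ?_ ?_ ?_ ?_
  · intro S _
    by_cases hS : ∀ z, σ z ∈ S ↔ z ∈ S
    · have hpow : ∀ (n : ℕ) (z : α), (σ ^ n) z ∈ S ↔ z ∈ S := by
        intro n
        induction n with
        | zero => simp
        | succ n ih => intro z; rw [pow_succ', Perm.mul_apply, hS, ih]
      by_cases hyS : y ∈ S
      · have hsub : C ⊆ S := fun z hz => by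
          obtain ⟨n, rfl⟩ := ((hC z).mp hz).exists_nat_pow_eq
          exact (hpow n y).mpr hyS
        have h := hdisj (S \ C) sdiff_disjoint
        rw [sdiff_union_of_subset hsub] at h
        rw [show symmDiff S C = S \ C by
          rw [symmDiff_def, sup_eq_union, sdiff_eq_empty_iff_subset.mpr hsub, union_empty]]
        rw [add_comm]; exact h
      · have hd : Disjoint S C := by
          rw [disjoint_right]
          intro z hz hzS
          obtain ⟨n, rfl⟩ := ((hC z).mp hz).exists_nat_pow_eq
          exact hyS ((hpow n y).mp hzS)
        rw [show symmDiff S C = S ∪ C from hd.symmDiff_eq_sup]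
        exact hdisj S hd
    · have hS' : ¬ ∀ z, σ z ∈ symmDiff S C ↔ z ∈ symmDiff S C := by
        intro h
        refine hS fun z => ?_
        have := h z
        simp only [mem_symmDiff, hinv z] at this
        tauto
      rw [signedWeight, signedWeight, dif_neg hS, dif_neg hS', add_zero]
  · intro S _ _ h
    have h' : y ∈ symmDiff S C ↔ y ∈ S := by rw [h]
    simp only [mem_symmDiff, hyC] at h'
    tauto
  · intro S hS
    simp only [mem_filter, mem_univ, true_and] at hS ⊢
    exact mem_symmDiff.mpr (Or.inl ⟨hS, hxC⟩)
  · intro S _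
    exact symmDiff_symmDiff_cancel_right _ _

lemma sum_card_mul_signedWeight (σ : Perm α) [Nonempty α] [Decidable (∀ x y, σ.SameCycle x y)] :
    ∑ S : Finset α, (S.card : ℚ) * signedWeight σ S =
      if ∀ x y, σ.SameCycle x y then -(Fintype.card α : ℚ) else 0 := by
  have hswap : ∑ S : Finset α, (S.card : ℚ) * signedWeight σ S =
      ∑ x : α, ∑ S : Finset α with x ∈ S, signedWeight σ S := by
    rw [Finset.sum_comm' (t' := univ) (s' := fun S => S) (by simp)]
    simp
  split_ifs with h
  · rw [hswap]
    have : ∀ x : α, ∑ S : Finset α with x ∈ S, signedWeight σ S = -1 := by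
      intro x
      rw [← signedWeight_orbit σ x univ (by simp [h x])]
      refine sum_eq_single_of_mem _ (by simp) fun S hS hne => ?_
      rw [signedWeight, dif_neg]
      intro hinv
      apply hne
      rw [eq_univ_iff_forall]
      intro z
      obtain ⟨n, rfl⟩ := (h x z).exists_nat_pow_eq
      clear hne
      induction n with
      | zero => simpa using hS
      | succ n ih => rwa [pow_succ', Perm.mul_apply, hinv]
    simp [this]
  · rw [hswap]
    refine sum_eq_zero fun x _ => ?_
    obtain ⟨y, hy⟩ : ∃ y, ¬ σ.SameCycle y x := by
      by_contra! hall
      exact h fun a b => (hall a).trans (hall b).symm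
    exact sum_signedWeight_eq_zero hy

end InvariantSets

lemma cycleType_eq_finRotate_iff_s15 {d : ℕ} (hd : 1 ≤ d) (σ : Equiv.Perm (Fin d)) :
    σ.cycleType = (finRotate d).cycleType ↔ ∀ x y, σ.SameCycle x y := by
  rcases hd.eq_or_lt with rfl | hd
  · exact ⟨fun _ x y => by rw [Subsingleton.elim x y], fun _ => by
      rw [Subsingleton.elim σ (finRotate 1)]⟩
  rw [cycleType_finRotate_of_le hd]
  constructor
  · intro h
    have hcyc : σ.IsCycle := by
      rw [← Equiv.Perm.card_cycleType_eq_one, h, Multiset.card_singleton]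
    rw [hcyc.cycleType, Multiset.singleton_inj] at h
    have hsupp : σ.support = Finset.univ := by
      rw [← Finset.card_eq_iff_eq_univ, h, Fintype.card_fin]
    have hne : ∀ x, σ x ≠ x := fun x =>
      Equiv.Perm.mem_support.mp (hsupp ▸ Finset.mem_univ x)
    exact fun x y => hcyc.sameCycle (hne x) (hne y)
  · intro h
    have : Nontrivial (Fin d) := Fin.nontrivial_iff_two_le.mpr hd
    have hne : ∀ x, σ x ≠ x := fun x hx => by
      obtain ⟨y, hy⟩ := exists_ne x
      exact hy ((h x y).eq_of_left hx).symm
    have hcyc : σ.IsCycle := ⟨⟨0, by omega⟩, hne _, fun y _ => h _ y⟩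
    have hsupp : σ.support = Finset.univ :=
      Finset.eq_univ_iff_forall.mpr fun x => Equiv.Perm.mem_support.mpr (hne x)
    rw [hcyc.cycleType, hsupp, Finset.card_univ, Fintype.card_fin]

section RankOne

open Function

variable {R M N ι : Type*} [CommRing R] [AddCommGroup M] [Module R M] [AddCommGroup N]
  [Module R N] [DecidableEq ι]

lemma AlternatingMap.map_update_piecewise_sub_smul (g : M [⋀^ι]→ₗ[R] N) (x : ι → M) (φ : ι → R)
    (u : M) (S : Finset ι) (j : ι) (hj : j ∉ S) :
    g (update (S.piecewise (fun i => x i - φ i • u) x) j u) = g (update x j u) := by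
  induction S using Finset.induction_on with
  | empty => simp
  | insert k S hk ih =>
    have hjk : j ≠ k := fun h => hj (h ▸ Finset.mem_insert_self _ _)
    have hjS : j ∉ S := fun h => hj (Finset.mem_insert_of_mem h)
    rw [Finset.piecewise_insert, update_comm hjk.symm, g.map_update_sub, g.map_update_smul,
      g.map_eq_zero_of_eq (update (update _ j u) k u) (i := j) (j := k) (by simp [hjk]) hjk,
      smul_zero, sub_zero]
    have : update (update (S.piecewise (fun i => x i - φ i • u) x) j u) k (x k) =
        update (S.piecewise (fun i => x i - φ i • u) x) j u := by
      rw [update_eq_self_iff, update_of_ne hjk.symm, Finset.piecewise_eq_of_notMem _ _ _ hk]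
    rw [this, ih hjS]

lemma AlternatingMap.map_sub_smul [Fintype ι] (g : M [⋀^ι]→ₗ[R] N) (x : ι → M) (φ : ι → R)
    (u : M) :
    g (fun i => x i - φ i • u) = g x - ∑ i, φ i • g (update x i u) := by
  suffices h : ∀ S : Finset ι, g (S.piecewise (fun i => x i - φ i • u) x) =
      g x - ∑ i ∈ S, φ i • g (update x i u) by
    simpa using h Finset.univ
  intro S
  induction S using Finset.induction_on with
  | empty => simp
  | insert k S hk ih =>
    rw [Finset.piecewise_insert, g.map_update_sub, g.map_update_smul,
      map_update_piecewise_sub_smul g x φ u S k hk, Finset.sum_insert hk]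
    have : update (S.piecewise (fun i => x i - φ i • u) x) k (x k) =
        S.piecewise (fun i => x i - φ i • u) x := by
      rw [update_eq_self_iff, Finset.piecewise_eq_of_notMem _ _ _ hk]
    rw [this, ih]
    abel

end RankOne

section StarBasis

open Finset

/-- The vectors `∑ eⱼ` (for `k = 0`) and `k eₖ - ∑_{j < k} eⱼ` (for `k > 0`), which diagonalise
the Laplacians of all stars centred at `b` with leaves `a < b`. -/
def starVector {d : ℕ} (k : Fin d) : Fin d → ℚ := fun j =>
  if (k : ℕ) = 0 then 1 else if j < k then -1 else if j = k then (k : ℕ) else 0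

/-- The eigenvalue of the star Laplacian centred at `b` on `starVector k`. -/
def starEigenvalue {d : ℕ} (b k : Fin d) : ℚ :=
  if (k : ℕ) = 0 ∨ b < k then 0 else if k = b then (b : ℕ) + 1 else 1

variable {d : ℕ}

lemma sum_starVector_of_subset (k : Fin d) (hk : (k : ℕ) ≠ 0) (s : Finset (Fin d))
    (hs : Iic k ⊆ s) : ∑ j ∈ s, starVector k j = 0 := by
  rw [← sum_subset hs fun j _ hj => ?_]
  · rw [← Iio_insert, sum_insert (by simp), sum_congr rfl
      fun j hj => show starVector k j = -1 by simp [starVector, hk, mem_Iio.mp hj]]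
    simp [starVector, hk]
  · have : k < j := by simpa using hj
    simp [starVector, hk, this.not_gt, this.ne']

lemma sum_starVector_mul (k l : Fin d) (hkl : k < l) :
    ∑ j, starVector k j * starVector l j = 0 := by
  have hl : (l : ℕ) ≠ 0 := by have : (k : ℕ) < l := hkl; omega
  by_cases hk : (k : ℕ) = 0
  · rw [sum_congr rfl fun j _ => show starVector k j * starVector l j = starVector l j by
      simp [starVector, hk]]
    exact sum_starVector_of_subset l hl _ (subset_univ _)
  · rw [sum_congr rfl fun j _ => show starVector k j * starVector l j = -starVector k j by
      by_cases hj : j ≤ k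
      · simp [starVector, hl, hj.trans_lt hkl]
      · simp [starVector, hk, not_lt.mpr (not_le.mp hj).le, (not_le.mp hj).ne'],
      sum_neg_distrib, sum_starVector_of_subset k hk _ (subset_univ _), neg_zero]

lemma linearIndependent_starVector : LinearIndependent ℚ (starVector (d := d)) := by
  have hpos : ∀ k : Fin d, ∑ j, starVector k j * starVector k j ≠ 0 := by
    intro k
    refine (sum_pos' (fun j _ => mul_self_nonneg _) ⟨k, mem_univ _, ?_⟩).ne'
    by_cases hk : (k : ℕ) = 0
    · simp [starVector, hk]
    · have : 0 < (k : ℕ) := Nat.pos_of_ne_zero hk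
      simp only [starVector, hk, lt_irrefl, if_false, if_true]
      positivity
  refine LinearIndependent.of_pairwise_dual_eq_zero_one _
    (fun k => (∑ j, starVector k j * starVector k j)⁻¹ •
      ∑ j, starVector k j • LinearMap.proj (R := ℚ) (φ := fun _ : Fin d => ℚ) j) ?_ ?_
  · intro k l hkl
    simp only [LinearMap.smul_apply, LinearMap.sum_apply, LinearMap.proj_apply, smul_eq_mul]
    rcases lt_or_gt_of_ne hkl with h | h
    · rw [sum_starVector_mul k l h, mul_zero]
    · have := sum_starVector_mul l k h
      simp_rw [mul_comm (starVector l _)] at this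
      rw [this, mul_zero]
  · intro k
    simp only [LinearMap.smul_apply, LinearMap.sum_apply, LinearMap.proj_apply, smul_eq_mul]
    exact inv_mul_cancel₀ (hpos k)

/-- The basis of `ℚ^d` formed by the vectors `starVector`. -/
noncomputable def starBasis (hd : 1 ≤ d) : Module.Basis (Fin d) ℚ (Fin d → ℚ) :=
  haveI : Nonempty (Fin d) := ⟨⟨0, hd⟩⟩
  basisOfLinearIndependentOfCardEqFinrank linearIndependent_starVector (by simp)

lemma coe_starBasis (hd : 1 ≤ d) : ⇑(starBasis hd) = starVector := by
  simp [starBasis]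

lemma starLaplacian_starVector (b k : Fin d) :
    ∑ a ∈ Iio b, (starVector k b - starVector k a) •
      (Pi.single b 1 - Pi.single a 1 : Fin d → ℚ) = starEigenvalue b k • starVector k := by
  ext j
  simp only [Finset.sum_apply, Pi.smul_apply, Pi.sub_apply, smul_eq_mul]
  rcases lt_trichotomy j b with hj | rfl | hj
  · rw [sum_eq_single_of_mem j (mem_Iio.mpr hj) fun a _ ha => by
      simp [hj.ne, ha.symm]]
    simp only [Pi.single_eq_same, Pi.single_eq_of_ne hj.ne]
    by_cases hk : (k : ℕ) = 0
    · simp [starVector, starEigenvalue, hk]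
    · rcases lt_trichotomy b k with h | rfl | h
      · simp [starVector, starEigenvalue, hk, h, hj.trans h]
      · simp [starVector, starEigenvalue, hk, hj]
      · simp [starVector, starEigenvalue, hk, h.not_gt, h.ne, h.ne']
  · have hterm : ∀ a ∈ Iio j, (starVector k j - starVector k a) *
        ((Pi.single j 1 : Fin d → ℚ) j - (Pi.single a 1 : Fin d → ℚ) j) =
          starVector k j - starVector k a := fun a ha => by
      simp [(mem_Iio.mp ha).ne']
    rw [sum_congr rfl hterm, sum_sub_distrib, sum_const, Fin.card_Iio, nsmul_eq_mul]
    by_cases hk : (k : ℕ) = 0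
    · simp [starVector, starEigenvalue, hk]
    · rcases lt_trichotomy j k with h | rfl | h
      · rw [sum_congr rfl fun a ha => show starVector k a = -1 by
          simp [starVector, hk, (mem_Iio.mp ha).trans h]]
        simp [starVector, starEigenvalue, hk, h]
      · rw [sum_congr rfl fun a ha => show starVector j a = -1 by
          simp [starVector, hk, mem_Iio.mp ha]]
        simp [starVector, starEigenvalue, hk]
        ring
      · rw [sum_starVector_of_subset k hk _ fun a ha =>
          mem_Iio.mpr ((mem_Iic.mp ha).trans_lt h)]
        simp [starVector, starEigenvalue, hk, h.not_gt, h.ne, h.ne']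
  · rw [sum_eq_zero fun a ha => by
      simp [hj.ne', ((mem_Iio.mp ha).trans hj).ne']]
    by_cases hk : (k : ℕ) = 0
    · simp [starEigenvalue, hk]
    · rcases lt_or_ge b k with h | h
      · simp [starEigenvalue, h]
      · simp [starVector, hk, (h.trans_lt hj).not_gt, (h.trans_lt hj).ne']

end StarBasis

section ExteriorRepresentation

open Finset Equiv

variable {d : ℕ}

/-- The action of permutations on the exterior powers of the permutation representation. -/
noncomputable def exteriorRep (d r : ℕ) :
    Perm (Fin d) →* Module.End ℚ (⋀[ℚ]^r (Fin d → ℚ)) where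
  toFun σ := exteriorPower.map r (LinearMap.funLeft ℚ ℚ (σ⁻¹ : Perm (Fin d)))
  map_one' := by
    exact exteriorPower.map_id
  map_mul' σ τ := by
    rw [mul_inv_rev, Perm.coe_mul, LinearMap.funLeft_comp]
    exact exteriorPower.map_comp _ _

lemma exteriorRep_apply_ιMulti (r : ℕ) (σ : Perm (Fin d)) (x : Fin r → Fin d → ℚ) :
    exteriorRep d r σ (exteriorPower.ιMulti ℚ r x) =
      exteriorPower.ιMulti ℚ r fun i => x i ∘ (σ⁻¹ : Perm (Fin d)) :=
  exteriorPower.map_apply_ιMulti _ _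

lemma det_eq_signedWeight (σ : Perm (Fin d)) (r : ℕ) (s : Set.powersetCard (Fin d) r) :
    (Matrix.of fun i j : Fin r =>
      (if σ (Set.powersetCard.ofFinEmbEquiv.symm s i) =
        Set.powersetCard.ofFinEmbEquiv.symm s j then (1 : ℚ) else 0)).det =
      (-1) ^ r * signedWeight σ (s : Finset (Fin d)) := by
  let A : Matrix (s : Finset (Fin d)) (s : Finset (Fin d)) ℚ :=
    Matrix.of fun x y => if σ x = y then 1 else 0
  have hA : (Matrix.of fun i j : Fin r =>
      (if σ (Set.powersetCard.ofFinEmbEquiv.symm s i) =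
        Set.powersetCard.ofFinEmbEquiv.symm s j then (1 : ℚ) else 0)) =
      A.submatrix ((s : Finset (Fin d)).orderIsoOfFin s.2).toEquiv
        ((s : Finset (Fin d)).orderIsoOfFin s.2).toEquiv := by
    ext i j
    simp [A, Set.powersetCard.ofFinEmbEquiv_symm_apply]
    rfl
  rw [hA, Matrix.det_submatrix_equiv_self]
  by_cases h : ∀ x, σ x ∈ (s : Finset (Fin d)) ↔ x ∈ (s : Finset (Fin d))
  · have hperm : A = Perm.permMatrix ℚ (σ.subtypePerm h) := by
      ext x y
      simp [A, Perm.permMatrix, PEquiv.toMatrix_apply, Subtype.ext_iff, eq_comm]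
    rw [hperm, Matrix.det_permutation, signedWeight, dif_pos h, ← mul_assoc,
      Set.powersetCard.card_eq, ← mul_pow]
    simp
  · have hout : ∃ x ∈ (s : Finset (Fin d)), σ x ∉ (s : Finset (Fin d)) := by
      by_contra! hall
      refine h fun x => ⟨fun hx => ?_, hall x⟩
      have himg : (s : Finset (Fin d)).image σ = s :=
        eq_of_subset_of_card_le (image_subset_iff.mpr hall)
          (card_image_of_injective _ σ.injective).ge
      rw [← himg, mem_image] at hx
      obtain ⟨y, hy, hyx⟩ := hx
      exact σ.injective hyx ▸ hy
    obtain ⟨x, hx, hσx⟩ := hout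
    rw [Matrix.det_eq_zero_of_row_eq_zero (⟨x, hx⟩ : (s : Finset (Fin d))), signedWeight,
      dif_neg h, mul_zero]
    intro y
    exact if_neg fun hxy : σ x = y => hσx (by rw [hxy]; exact y.2)

lemma trace_exteriorRep (r : ℕ) (σ : Perm (Fin d)) :
    LinearMap.trace ℚ _ (exteriorRep d r σ) =
      ∑ s : Set.powersetCard (Fin d) r, (-1) ^ r * signedWeight σ (s : Finset (Fin d)) := by
  let e := Pi.basisFun ℚ (Fin d)
  rw [LinearMap.trace_eq_matrix_trace ℚ (e.exteriorPower r), Matrix.trace]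
  refine sum_congr rfl fun s _ => ?_
  rw [Matrix.diag_apply, LinearMap.toMatrix_apply, exteriorPower.basis_apply,
    exteriorPower.basis_repr_apply, exteriorPower.ιMulti_family, exteriorRep_apply_ιMulti,
    exteriorPower.ιMultiDual_apply_ιMulti, ← det_eq_signedWeight]
  congr 1
  ext i j
  simp only [Matrix.of_apply]
  simp [e, Pi.single_apply]
  exact if_congr (by rw [Equiv.symm_apply_eq, eq_comm]) rfl rfl

lemma trace_eq_sum_of_eigenvector {I V : Type*} [Fintype I] [AddCommGroup V] [Module ℚ V]
    (b : Module.Basis I ℚ V) (f : Module.End ℚ V) (c : I → ℚ) (h : ∀ i, f (b i) = c i • b i) :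
    LinearMap.trace ℚ V f = ∑ i, c i := by
  classical
  rw [LinearMap.trace_eq_matrix_trace ℚ b, Matrix.trace]
  refine sum_congr rfl fun i _ => ?_
  rw [Matrix.diag_apply, LinearMap.toMatrix_apply, h]
  simp

/-- The eigenvalue of the Jucys–Murphy element `∑_{a < b} (a b)` on the exterior product of the
vectors `starVector k`, `k ∈ S`. -/
def jucysMurphyEigenvalue (S : Finset (Fin d)) (b : Fin d) : ℚ :=
  (b : ℕ) - ∑ k ∈ S, starEigenvalue b k

lemma sum_exteriorRep_swap_apply (r : ℕ) (s : Set.powersetCard (Fin d) r) (b : Fin d) :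
    (∑ a ∈ Iio b, exteriorRep d r (swap a b)) (exteriorPower.ιMulti_family ℚ r starVector s) =
      jucysMurphyEigenvalue (s : Finset (Fin d)) b •
        exteriorPower.ιMulti_family ℚ r starVector s := by
  set x : Fin r → Fin d → ℚ := starVector ∘ Set.powersetCard.ofFinEmbEquiv.symm s with hx
  have hfam : exteriorPower.ιMulti_family ℚ r starVector s = exteriorPower.ιMulti ℚ r x := rfl
  rw [hfam, LinearMap.sum_apply]
  have hswap : ∀ a ∈ Iio b, exteriorRep d r (swap a b) (exteriorPower.ιMulti ℚ r x) =
      exteriorPower.ιMulti ℚ r x - ∑ i, (x i b - x i a) •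
        exteriorPower.ιMulti ℚ r
          (Function.update x i (Pi.single b 1 - Pi.single a 1 : Fin d → ℚ)) := by
    intro a ha
    have hab := mem_Iio.mp ha
    rw [exteriorRep_apply_ιMulti, ← AlternatingMap.map_sub_smul]
    congr 1
    ext i j
    rw [swap_inv, Function.comp_apply, swap_apply_def]
    simp only [Pi.sub_apply, Pi.smul_apply, smul_eq_mul, Pi.single_apply]
    split_ifs with h1 h2 <;> simp_all
  have hcomm : ∀ i, ∑ a ∈ Iio b, (x i b - x i a) • exteriorPower.ιMulti ℚ r
          (Function.update x i (Pi.single b 1 - Pi.single a 1 : Fin d → ℚ)) =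
      starEigenvalue b (Set.powersetCard.ofFinEmbEquiv.symm s i) •
        exteriorPower.ιMulti ℚ r x := by
    intro i
    simp_rw [← AlternatingMap.map_update_smul]
    rw [← AlternatingMap.map_update_sum, hx]
    simp only [Function.comp_apply]
    rw [starLaplacian_starVector, AlternatingMap.map_update_smul]
    congr 2
    exact Function.update_eq_self_iff.mpr rfl
  have hsum : ∑ i, starEigenvalue b (Set.powersetCard.ofFinEmbEquiv.symm s i) =
      ∑ k ∈ (s : Finset (Fin d)), starEigenvalue b k := by
    rw [← sum_coe_sort (s : Finset (Fin d)),
      ← ((s : Finset (Fin d)).orderIsoOfFin s.2).toEquiv.sum_comp]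
    simp [Set.powersetCard.ofFinEmbEquiv_symm_apply]
    rfl
  rw [sum_congr rfl hswap, sum_sub_distrib, sum_comm, sum_congr rfl fun i _ => hcomm i,
    ← sum_smul, hsum, sum_const, Fin.card_Iio, jucysMurphyEigenvalue,
    ← Nat.cast_smul_eq_nsmul ℚ]
  exact (sub_smul _ _ _).symm

lemma sum_prod_ofFn_apply {V : Type*} [AddCommGroup V] [Module ℚ V]
    (T : Fin d → Fin d → Module.End ℚ V) (c : Fin d → ℚ) (v : V)
    (h : ∀ b, (∑ a ∈ Iio b, T a b) v = c b • v) {m : ℕ} (b : Fin m → Fin d) :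
    ∑ a : Fin m → Fin d with ∀ i, a i < b i, (List.ofFn fun i => T (a i) (b i)).prod v =
      (∏ i, c (b i)) • v := by
  induction m with
  | zero => simp
  | succ m ih =>
    rw [sum_filter, ← (Fin.consEquiv fun _ => Fin d).sum_comp, Fintype.sum_prod_type]
    simp only [Fin.consEquiv_apply, Fin.forall_fin_succ, Fin.cons_zero, Fin.cons_succ,
      List.ofFn_succ, List.prod_cons, Module.End.mul_apply, ite_and]
    have hinner : ∀ a₀ : Fin d, (∑ a : Fin m → Fin d, if a₀ < b 0 then
        (if ∀ i, a i < b i.succ then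
          T a₀ (b 0) ((List.ofFn fun i => T (a i) (b i.succ)).prod v) else 0) else 0) =
        if a₀ < b 0 then (∏ i : Fin m, c (b i.succ)) • T a₀ (b 0) v else 0 := by
      intro a₀
      split_ifs
      · rw [← map_smul, ← ih, sum_filter, map_sum]
        refine sum_congr rfl fun a _ => ?_
        split_ifs <;> simp
      · simp
    rw [sum_congr rfl fun a₀ _ => hinner a₀, ← sum_filter, ← smul_sum,
      show (univ.filter fun a₀ => a₀ < b 0) = Iio (b 0) by ext; simp,
      ← LinearMap.sum_apply, h, smul_smul, Fin.prod_univ_succ, mul_comm]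

end ExteriorRepresentation

section Words

open Finset Equiv

variable {d : ℕ}

lemma sum_starEigenvalue (S : Finset (Fin d)) (b : Fin d) :
    ∑ k ∈ S, starEigenvalue b k =
      (#(S.filter fun k : Fin d => 0 < (k : ℕ) ∧ k < b) : ℕ) +
        if b ∈ S ∧ 0 < (b : ℕ) then ((b : ℕ) : ℚ) + 1 else 0 := by
  have h : ∀ k ∈ S, starEigenvalue b k = (if 0 < (k : ℕ) ∧ k < b then 1 else 0) +
      if k = b then (if 0 < (b : ℕ) then ((b : ℕ) : ℚ) + 1 else 0) else 0 := by
    intro k _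
    rcases Nat.eq_zero_or_pos (k : ℕ) with hk | hk
    · by_cases hkb : k = b
      · subst hkb
        simp [starEigenvalue, hk]
      · simp [starEigenvalue, hk, hkb]
    · rcases lt_trichotomy k b with h | rfl | h
      · simp [starEigenvalue, hk, hk.ne', h, h.ne, h.not_gt]
      · simp [starEigenvalue, hk, hk.ne']
      · simp [starEigenvalue, h, h.ne', h.not_gt]
  rw [sum_congr rfl h, sum_add_distrib, sum_boole, sum_ite_eq']
  simp [ite_and]

lemma prod_jucysMurphyEigenvalue {M : Type*} [CommMonoid M] (F : ℚ → M) (S : Finset (Fin d)) :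
    ∏ b, F (jucysMurphyEigenvalue S b) =
      ∏ j ∈ range d, F ((j : ℚ) - (#(S.filter fun k : Fin d => 0 < (k : ℕ)) : ℕ)) := by
  suffices h : ∀ e (he : e ≤ d), ∏ b : Fin e, F (jucysMurphyEigenvalue S (b.castLE he)) =
      ∏ j ∈ range e, F ((j : ℚ) - (#(S.filter fun k : Fin d => 0 < (k : ℕ) ∧ (k : ℕ) < e) : ℕ)) by
    simpa using h d le_rfl
  intro e
  induction e with
  | zero => simp
  | succ e ih =>
    intro he
    let b : Fin d := ⟨e, he⟩
    have hlast : (Fin.last e).castLE he = b := rfl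
    have hb := sum_starEigenvalue S b
    have hlt : #(S.filter fun k : Fin d => 0 < (k : ℕ) ∧ k < b) =
        #(S.filter fun k : Fin d => 0 < (k : ℕ) ∧ (k : ℕ) < e) := rfl
    rw [hlt] at hb
    rw [Fin.prod_univ_castSucc, hlast]
    have hprev := ih (by omega)
    rw [show ∏ i : Fin e, F (jucysMurphyEigenvalue S (i.castSucc.castLE he)) =
      ∏ i : Fin e, F (jucysMurphyEigenvalue S (i.castLE (by omega))) from rfl, hprev,
      jucysMurphyEigenvalue, hb]
    by_cases hmem : b ∈ S ∧ 0 < (b : ℕ)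
    · have hins : (S.filter fun k : Fin d => 0 < (k : ℕ) ∧ (k : ℕ) < e + 1) =
          insert b (S.filter fun k : Fin d => 0 < (k : ℕ) ∧ (k : ℕ) < e) := by
        ext k
        simp only [mem_filter, mem_insert, Fin.ext_iff, b]
        constructor
        · rintro ⟨h1, h2, h3⟩
          by_cases hk : (k : ℕ) = e
          · exact Or.inl hk
          · exact Or.inr ⟨h1, h2, by omega⟩
        · rintro (h | ⟨h1, h2, h3⟩)
          · have : k = b := Fin.ext h
            exact ⟨this ▸ hmem.1, this ▸ hmem.2, by omega⟩
          · exact ⟨h1, h2, by omega⟩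
      rw [hins, card_insert_of_notMem (by simp [b]), prod_range_succ', if_pos hmem]
      congr 1
      · refine prod_congr rfl fun j _ => ?_
        congr 1
        push_cast
        ring
      · congr 1
        push_cast
        ring
    · have hins : (S.filter fun k : Fin d => 0 < (k : ℕ) ∧ (k : ℕ) < e + 1) =
          S.filter fun k : Fin d => 0 < (k : ℕ) ∧ (k : ℕ) < e := by
        refine filter_congr fun k hk => ?_
        refine and_congr_right fun hk0 => ⟨fun hke => ?_, fun hke => by omega⟩
        by_contra hne
        have : k = b := Fin.ext (show (k : ℕ) = e by omega)
        exact hmem ⟨this ▸ hk, this ▸ hk0⟩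
      rw [hins, prod_range_succ, if_neg hmem, add_zero]

lemma sum_trace_exteriorRep (hd : 1 ≤ d) (r m : ℕ)
    [DecidablePred (Monotone : (Fin m → Fin d) → Prop)] :
    ∑ b : Fin m → Fin d with Monotone b, ∑ a : Fin m → Fin d with ∀ i, a i < b i,
      LinearMap.trace ℚ _ (exteriorRep d r (List.ofFn fun i => swap (a i) (b i)).prod) =
        ∑ s : Set.powersetCard (Fin d) r,
          monotoneSum (jucysMurphyEigenvalue (s : Finset (Fin d))) m := by
  simp_rw [← map_sum]
  refine trace_eq_sum_of_eigenvector ((starBasis hd).exteriorPower r) _ _ fun s => ?_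
  rw [exteriorPower.basis_apply, coe_starBasis, LinearMap.sum_apply, monotoneSum, sum_smul]
  refine sum_congr (by congr) fun b _ => ?_
  rw [← sum_prod_ofFn_apply (fun a b => exteriorRep d r (swap a b)) _ _
    (sum_exteriorRep_swap_apply r s) b, LinearMap.sum_apply]
  refine sum_congr rfl fun a _ => ?_
  rw [map_list_prod, List.map_ofFn]
  rfl

lemma cast_mono_eq_sum (m : ℕ) [DecidablePred (Monotone : (Fin m → Fin d) → Prop)] :
    (Mono d m : ℚ) = ∑ b : Fin m → Fin d with Monotone b,
      ∑ a : Fin m → Fin d with ∀ i, a i < b i,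
        if (List.ofFn fun i => swap (a i) (b i)).prod.cycleType = (finRotate d).cycleType
          then 1 else 0 := by
  classical
  rw [Mono, Nat.card_eq_fintype_card, Fintype.card_subtype, ← sum_boole,
    ← (Equiv.arrowProdEquivProdArrow (Fin m) (fun _ => Fin d) (fun _ => Fin d)).symm.sum_comp,
    Fintype.sum_prod_type, sum_comm, sum_filter]
  refine sum_congr rfl fun b _ => ?_
  by_cases hb : Monotone b
  · rw [if_pos hb, sum_filter]
    refine sum_congr rfl fun a _ => ?_
    rw [← ite_and]
    refine if_congr ?_ rfl rfl
    exact and_congr_right fun _ => and_iff_right fun i j hij => hb hij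
  · rw [if_neg hb]
    exact sum_eq_zero fun a _ => if_neg fun h => hb fun i j hij => h.2.1 i j hij

lemma sum_eq_sum_range_sum_powersetCard (f : Finset (Fin d) → ℚ) :
    ∑ S, f S = ∑ r ∈ range (d + 1), ∑ s : Set.powersetCard (Fin d) r, f s := by
  rw [← powerset_univ, sum_powerset, card_univ, Fintype.card_fin]
  refine sum_congr rfl fun r _ => ?_
  exact sum_subtype _ (fun S => by simp [Set.powersetCard.mem_iff]) f

lemma mul_mono_eq_sum (hd : 1 ≤ d) (m : ℕ) :
    (d : ℚ) * Mono d m =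
      -∑ S : Finset (Fin d), (-1) ^ #S * (#S : ℚ) * monotoneSum (jucysMurphyEigenvalue S) m := by
  classical
  have : Nonempty (Fin d) := ⟨⟨0, hd⟩⟩
  have hσ : ∀ σ : Perm (Fin d),
      (d : ℚ) * (if σ.cycleType = (finRotate d).cycleType then 1 else 0) =
        -∑ r ∈ range (d + 1), (-1) ^ r * (r : ℚ) * LinearMap.trace ℚ _ (exteriorRep d r σ) := by
    intro σ
    have h := sum_card_mul_signedWeight σ
    rw [sum_eq_sum_range_sum_powersetCard] at h
    have h' : ∑ r ∈ range (d + 1), (-1) ^ r * (r : ℚ) * LinearMap.trace ℚ _ (exteriorRep d r σ) =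
        if ∀ x y, σ.SameCycle x y then -(d : ℚ) else 0 := by
      rw [Fintype.card_fin] at h
      rw [← h]
      refine sum_congr rfl fun r _ => ?_
      rw [trace_exteriorRep, mul_sum]
      refine sum_congr rfl fun s _ => ?_
      rw [Set.powersetCard.card_eq, mul_comm ((-1 : ℚ) ^ r), mul_assoc, ← mul_assoc ((-1 : ℚ) ^ r),
        ← mul_pow]
      simp
    rw [h', if_congr (cycleType_eq_finRotate_iff_s15 hd σ) rfl rfl]
    split_ifs <;> simp
  rw [cast_mono_eq_sum, sum_eq_sum_range_sum_powersetCard, mul_sum]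
  simp_rw [mul_sum, hσ, sum_neg_distrib]
  congr 1
  rw [sum_congr rfl fun b _ => sum_comm, sum_comm]
  refine sum_congr rfl fun r _ => ?_
  simp_rw [← mul_sum]
  rw [sum_trace_exteriorRep hd, mul_sum]
  exact sum_congr rfl fun s _ => by rw [Set.powersetCard.card_eq]

end Words

section Evaluation

open Finset

lemma mk_monotoneSum_mul_prod_range (d r : ℕ) :
    PowerSeries.mk (monotoneSum fun i : Fin d => ((i : ℕ) : ℚ) - r) *
      ∏ j ∈ range d, (1 - PowerSeries.C ((j : ℚ) - r) * PowerSeries.X) = 1 := by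
  rw [← Fin.prod_univ_eq_prod_range
    fun j => (1 - PowerSeries.C ((j : ℚ) - r) * PowerSeries.X : PowerSeries ℚ)]
  exact mk_monotoneSum_mul_prod fun i : Fin d => ((i : ℕ) : ℚ) - r

lemma monotoneSum_jucysMurphyEigenvalue {d : ℕ} (S : Finset (Fin d)) (m : ℕ) :
    monotoneSum (jucysMurphyEigenvalue S) m =
      monotoneSum (fun i : Fin d =>
        ((i : ℕ) : ℚ) - (#(S.filter fun k : Fin d => 0 < (k : ℕ)) : ℕ)) m := by
  have h := mk_monotoneSum_mul_prod (jucysMurphyEigenvalue S)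
  rw [prod_jucysMurphyEigenvalue fun q => 1 - PowerSeries.C q * PowerSeries.X] at h
  have h' := mk_monotoneSum_mul_prod_range d #(S.filter fun k : Fin d => 0 < (k : ℕ))
  rw [mul_comm] at h'
  simpa using congrArg (PowerSeries.coeff m) (left_inv_eq_right_inv h h')

lemma succ_mul_mono (n m : ℕ) :
    ((n : ℚ) + 1) * Mono (n + 1) m = ∑ r ∈ range (n + 1),
      (-1) ^ r * (n.choose r : ℚ) * monotoneSum (fun i : Fin (n + 1) => ((i : ℕ) : ℚ) - r) m := by
  have h := mul_mono_eq_sum (Nat.le_add_left 1 n) m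
  push_cast at h
  have h0 : (0 : Fin (n + 1)) ∉ univ.erase (0 : Fin (n + 1)) := by simp
  rw [h, ← powerset_univ, ← insert_erase (mem_univ (0 : Fin (n + 1))), sum_powerset_insert h0,
    ← sum_add_distrib, ← sum_neg_distrib]
  have hcard : #(univ.erase (0 : Fin (n + 1))) = n := by simp
  have hsum := sum_powerset_apply_card (x := univ.erase (0 : Fin (n + 1))) fun r =>
    (-1) ^ r * monotoneSum (fun i : Fin (n + 1) => ((i : ℕ) : ℚ) - r) m
  rw [hcard] at hsum
  rw [sum_congr rfl fun r _ => show (-1 : ℚ) ^ r * (n.choose r : ℚ) *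
      monotoneSum (fun i : Fin (n + 1) => ((i : ℕ) : ℚ) - r) m = n.choose r •
        ((-1) ^ r * monotoneSum (fun i : Fin (n + 1) => ((i : ℕ) : ℚ) - r) m) by
      rw [nsmul_eq_mul]; ring, ← hsum]
  refine sum_congr rfl fun t ht => ?_
  have ht0 : 0 ∉ t := fun h => h0 (mem_powerset.mp ht h)
  have hfilter : (t.filter fun k : Fin (n + 1) => 0 < (k : ℕ)) = t :=
    filter_true_of_mem fun k hk => Nat.pos_of_ne_zero fun h =>
      ht0 ((Fin.ext h : k = 0) ▸ hk)
  rw [monotoneSum_jucysMurphyEigenvalue, monotoneSum_jucysMurphyEigenvalue, filter_insert,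
    if_neg (by simp), hfilter, card_insert_of_notMem ht0]
  push_cast
  ring

lemma factorial_mul_succ_mul_mono (n g : ℕ) :
    (n.factorial : ℚ) * (((n : ℚ) + 1) * Mono (n + 1) (n + 2 * g)) =
      (2 * n).factorial * hsymmSquares g n := by
  rw [← coeff_sum_choose_mul n g
    (fun r => PowerSeries.mk (monotoneSum fun i : Fin (n + 1) => ((i : ℕ) : ℚ) - r))
    fun r _ => by simpa using mk_monotoneSum_mul_prod_range (n + 1) r, succ_mul_mono, map_sum]
  congr 1
  refine sum_congr rfl fun r _ => ?_
  rw [show ((-1) ^ r * (n.choose r : PowerSeries ℚ)) =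
    PowerSeries.C ((-1) ^ r * (n.choose r : ℚ)) by simp, PowerSeries.coeff_C_mul,
    PowerSeries.coeff_mk]

lemma monotoneHurwitz_succ (g n : ℕ) :
    monotoneHurwitz g (n + 1) =
      ((2 * n).factorial : ℚ) * hsymmSquares g n / (n.factorial ^ 2 * (n + 1)) := by
  rw [← factorial_mul_succ_mul_mono, monotoneHurwitz, Nat.add_sub_cancel,
    show n + 1 + 2 * g - 1 = n + 2 * g by omega]
  have : (n.factorial : ℚ) ≠ 0 := by positivity
  have : (n : ℚ) + 1 ≠ 0 := by positivity
  field_simp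

end Evaluation

/-- Polynomial structure of 1-part monotone Hurwitz numbers: for every `g ≥ 1` there is
a polynomial `p_g ∈ ℚ[x]` of degree `3g−1` with `m_g(d) = C(2d,d)·p_g(d)` for all
`d ≥ 1`. -/
theorem monotone_hurwitz_polynomial (g : ℕ) (hg : 1 ≤ g) :
    ∃ p : Polynomial ℚ, p.natDegree = 3 * g - 1 ∧
      ∀ d : ℕ, 1 ≤ d →
        monotoneHurwitz g d = ((2 * d).choose d : ℚ) * p.eval (d : ℚ) := by
  obtain ⟨p, hdeg, hp⟩ := exists_polynomial_hsymmSquares g hg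
  refine ⟨p, hdeg, fun d hd => ?_⟩
  obtain ⟨n, rfl⟩ := Nat.exists_eq_add_of_le' hd
  have hbinom : (((2 * (n + 1)).choose (n + 1) : ℕ) : ℚ) * (n + 1) =
      2 * (2 * n + 1) * n.centralBinom := by
    have := Nat.succ_mul_centralBinom_succ n
    rw [Nat.centralBinom_eq_two_mul_choose (n + 1), mul_comm] at this
    exact_mod_cast this
  have hcentral : (n.centralBinom : ℚ) * n.factorial ^ 2 = (2 * n).factorial := by
    have := Nat.choose_mul_factorial_mul_factorial (show n ≤ 2 * n by omega)
    rw [show 2 * n - n = n by omega, ← Nat.centralBinom_eq_two_mul_choose, mul_assoc,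
      ← pow_two] at this
    exact_mod_cast this
  rw [monotoneHurwitz_succ, hp, ← hcentral, div_eq_iff (by positivity)]
  linear_combination -(n.factorial : ℚ) ^ 2 * p.eval ((n + 1 : ℕ) : ℚ) * hbinom
end
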